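/- arXiv:math/9712202 — 2 statements merged into one kernel-verified Lean document; each statement's English description precedes it below -/
import Mathlib

section
/- Let m, n be nonnegative integers with m ≤ n. Then there exists a polynomial P(X) with rational coefficients of degree at most ⌊m/2⌋ such that for all nonnegative integers x with x + m ≥ 1, E(x,x+m;n) = ∏_{i=0}^{n−1} [ (2x+m+i−1)! · (3x+m+2i+1)_i · (3x+2m+2i+1)_i / ((x+2i+1)! · (x+m+2i+1)!) ] · (x+m)_{⌊n/2⌋−⌊m/2⌋} · P(x). (Proposition 5) -/
open Finset

/-- The Pochhammer symbol `(a)_k = a(a+1)⋯(a+k-1)`. -/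
noncomputable def poch (a : ℚ) (k : ℕ) : ℚ := ∏ i ∈ Finset.range k, (a + i)

/-- `rfac k = k!` for `k ≥ 0`, and `0` for negative `k`. -/
noncomputable def rfac (k : ℤ) : ℚ := if 0 ≤ k then (Nat.factorial k.toNat : ℚ) else 0

/-- `rfacInv k = 1/k!` for `k ≥ 0`, and `0` for negative `k`. -/
noncomputable def rfacInv (k : ℤ) : ℚ := if 0 ≤ k then (Nat.factorial k.toNat : ℚ)⁻¹ else 0

/-- The determinant `E(x,y;n)` with `(i,j)`-entry
`(x+y+i+j−1)! (y−x+3j−3i) / ((x+2i−j+1)! (y+2j−i+1)!)`. -/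
noncomputable def Edet (x y n : ℕ) : ℚ :=
  Matrix.det (Matrix.of fun i j : Fin n =>
    rfac ((x : ℤ) + (y : ℤ) + (i : ℕ) + (j : ℕ) - 1) *
      (((y : ℤ) - (x : ℤ) + 3 * ((j : ℕ) : ℤ) - 3 * ((i : ℕ) : ℤ)) : ℚ) *
      rfacInv ((x : ℤ) + 2 * (i : ℕ) - (j : ℕ) + 1) *
      rfacInv ((y : ℤ) + 2 * (j : ℕ) - (i : ℕ) + 1))


/-- The rising factorial `a(a+1)⋯(a+k-1)` in a commutative ring. -/
def rising {R : Type*} [CommRing R] (a : R) (k : ℕ) : R := ∏ i ∈ Finset.range k, (a + i)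

lemma rising_succ {R : Type*} [CommRing R] (a : R) (k : ℕ) :
    rising a (k + 1) = rising a k * (a + k) := by
  simp [rising, Finset.prod_range_succ]

lemma rising_succ' {R : Type*} [CommRing R] (a : R) (k : ℕ) :
    rising a (k + 1) = a * rising (a + 1) k := by
  simp only [rising, Finset.prod_range_succ', Nat.cast_zero, add_zero, Nat.cast_add, Nat.cast_one]
  rw [mul_comm]
  congr 1
  exact Finset.prod_congr rfl fun i _ => by ring

lemma map_rising {R S : Type*} [CommRing R] [CommRing S] (f : R →+* S) (a : R) (k : ℕ) :
    f (rising a k) = rising (f a) k := by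
  simp [rising]

lemma rising_pos {a : ℚ} (ha : 0 < a) (k : ℕ) : 0 < rising a k :=
  Finset.prod_pos fun i _ => by positivity

lemma rising_dvd_rising {R : Type*} [CommRing R] (a : R) {k l : ℕ} (h : k ≤ l) :
    rising a k ∣ rising a l :=
  Finset.prod_dvd_prod_of_subset _ _ _ (Finset.range_subset_range.2 h)

/-- The polynomial `∑ k, (-1) ^ k * n.choose k * (x)_k * (y)_{n-k}`, given by its three-term
recurrence in `n`. -/
def altRising {R : Type*} [CommRing R] (x y : R) : ℕ → R
  | 0 => 1
  | 1 => y - x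
  | n + 2 => (y - x) * altRising x y (n + 1) + (n + 1) * (n + x + y) * altRising x y n

section altRising

variable {R : Type*} [CommRing R]

lemma map_altRising {S : Type*} [CommRing S] (f : R →+* S) (x y : R) (n : ℕ) :
    f (altRising x y n) = altRising (f x) (f y) n := by
  induction n using Nat.twoStepInduction with
  | zero => simp [altRising]
  | one => simp [altRising]
  | more n ih1 ih2 => simp [altRising, ih1, ih2]

lemma altRising_pos {x y : ℚ} (h1 : 0 < x) (h2 : x < y) (n : ℕ) : 0 < altRising x y n := by
  have h3 : 0 < y := h1.trans h2
  have h4 : 0 < y - x := sub_pos.2 h2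
  induction n using Nat.twoStepInduction with
  | zero => simp [altRising]
  | one => simpa [altRising] using h2
  | more n ih1 ih2 =>
    rw [altRising]
    positivity

lemma altRising_swap (x y : R) (n : ℕ) : altRising y x n = (-1) ^ n * altRising x y n := by
  induction n using Nat.twoStepInduction with
  | zero => simp [altRising]
  | one => simp [altRising]
  | more n ih1 ih2 =>
    simp only [altRising, ih1, ih2, pow_succ]
    ring

lemma altRising_left_succ (x y : R) (n : ℕ) :
    altRising x y (n + 1) = altRising (x + 1) y (n + 1) + (n + 1) * altRising (x + 1) y n := by
  induction n using Nat.twoStepInduction with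
  | zero => simp [altRising]; ring
  | one => simp [altRising]; ring
  | more n ih1 ih2 =>
    rw [altRising, ih1, ih2]
    simp only [altRising]
    push_cast
    ring

lemma altRising_succ_eq_diag (x y : R) (n : ℕ) :
    altRising x y (n + 2) = (y - x) * altRising (x + 1) (y + 1) (n + 1)
      + (n + 1) * (x + y) * altRising (x + 1) (y + 1) n := by
  induction n using Nat.twoStepInduction with
  | zero => simp [altRising]
  | one => simp [altRising]; ring
  | more n ih1 ih2 =>
    rw [altRising, ih1, ih2]
    simp only [altRising]
    push_cast
    ring

lemma mul_altRising_eq_diag (x y : R) (n : ℕ) :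
    (n + 1 + x + y) * altRising x y (n + 1) = (x + y) * altRising (x + 1) (y + 1) (n + 1)
      + (n + 1) * (y - x) * altRising (x + 1) (y + 1) n := by
  cases n with
  | zero => simp [altRising]; ring
  | succ n =>
    rw [altRising_succ_eq_diag]
    simp only [altRising]
    push_cast
    ring

lemma mul_altRising_add_two_sub_one (x y : R) (n : ℕ) :
    (x + 1) * altRising (x + 2) (y - 1) (n + 1) =
      (x + 2 * n + 3) * altRising (x + 1) (y + 1) (n + 1)
      - (n + 1) * (x + 2 * n + 3 + 2 * y) * altRising (x + 1) (y + 1) n := by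
  induction n using Nat.twoStepInduction with
  | zero => simp [altRising]; ring
  | one => simp [altRising]; ring
  | more n ih1 ih2 =>
    rw [altRising, mul_add, mul_left_comm, ih2, mul_left_comm, ih1]
    simp only [altRising]
    push_cast
    ring

lemma mul_altRising_sub_one_add_two (x y : R) (n : ℕ) :
    (y + 1) * altRising (x - 1) (y + 2) (n + 1) =
      (y + 2 * n + 3) * altRising (x + 1) (y + 1) (n + 1)
      + (n + 1) * (y + 2 * n + 3 + 2 * x) * altRising (x + 1) (y + 1) n := by
  rw [altRising_swap (y + 2) (x - 1), altRising_swap (y + 1) (x + 1),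
    altRising_swap (y + 1) (x + 1) n, mul_left_comm, mul_altRising_add_two_sub_one]
  ring

/-- The quadratic relation behind the condensation recurrence for `polyDet`. -/
lemma altRising_condensation (x y : R) (n : ℕ) :
    (n + 1) * (2 * x + y + 2 * n + 3) * (x + 2 * y + 2 * n + 3) *
        (altRising x y (n + 2) * altRising (x + 1) (y + 1) n) =
      (x + y + n + 1) * (x + 2 * n + 3) * (y + 2 * n + 3) *
        (altRising x y (n + 1) * altRising (x + 1) (y + 1) (n + 1))
      - (x + 1) * (y + 1) * (x + y) *
        (altRising (x + 2) (y - 1) (n + 1) * altRising (x - 1) (y + 2) (n + 1)) := by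
  linear_combination
    (n + 1) * (2 * x + y + 2 * n + 3) * (x + 2 * y + 2 * n + 3) *
      altRising (x + 1) (y + 1) n * altRising_succ_eq_diag x y n
    - (x + 2 * n + 3) * (y + 2 * n + 3) * altRising (x + 1) (y + 1) (n + 1) *
      mul_altRising_eq_diag x y n
    + (x + y) * (y + 1) * altRising (x - 1) (y + 2) (n + 1) *
      mul_altRising_add_two_sub_one x y n
    + (x + y) * ((x + 2 * n + 3) * altRising (x + 1) (y + 1) (n + 1)
      - (n + 1) * (x + 2 * n + 3 + 2 * y) * altRising (x + 1) (y + 1) n) *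
      mul_altRising_sub_one_add_two x y n

lemma altRising_self_odd (x : R) (k : ℕ) : altRising x x (2 * k + 1) = 0 := by
  induction k with
  | zero => simp [altRising]
  | succ k ih =>
    rw [show 2 * (k + 1) + 1 = 2 * k + 1 + 2 by ring, altRising, ih]
    simp

lemma rising_dvd_altRising_self (x : R) (k : ℕ) : rising x k ∣ altRising x x (2 * k) := by
  induction k with
  | zero => simp [rising]
  | succ k ih =>
    rw [show 2 * (k + 1) = 2 * k + 2 by ring, altRising, rising_succ, sub_self, zero_mul, zero_add,
      mul_comm]
    refine mul_dvd_mul ⟨(2 * k + 1) * 2, by push_cast; ring⟩ ih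

lemma rising_dvd_altRising (x : R) (m n : ℕ) :
    rising x ((n + 1 - m) / 2) ∣ altRising (x - m) x n := by
  induction m generalizing n with
  | zero =>
    rcases Nat.even_or_odd' n with ⟨k, rfl | rfl⟩
    · simpa [show (2 * k + 1) / 2 = k by omega] using rising_dvd_altRising_self x k
    · simp [altRising_self_odd]
  | succ m ih =>
    cases n with
    | zero => simp [rising]
    | succ n =>
      rw [altRising_left_succ, show x - (m + 1 : ℕ) + 1 = x - m by push_cast; ring]
      refine dvd_add ((rising_dvd_rising x (by omega)).trans (ih _)) (Dvd.dvd.mul_left ?_ _)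
      exact (rising_dvd_rising x (by omega)).trans (ih n)

end altRising

open Polynomial in
lemma natDegree_altRising_le (p : ℚ[X]) (hp : p.natDegree ≤ 1) (m n : ℕ) :
    (altRising (p - (m : ℚ[X])) p n).natDegree ≤ n / 2 := by
  induction m generalizing n with
  | zero =>
    rw [Nat.cast_zero, sub_zero]
    rcases Nat.even_or_odd' n with ⟨k, rfl | rfl⟩
    · induction k with
      | zero => simp [altRising]
      | succ k ih =>
        rw [show 2 * (k + 1) = 2 * k + 2 by ring, altRising, sub_self, zero_mul, zero_add]
        have h : ((((2 * k : ℕ) : ℚ[X]) + 1) * ((2 * k : ℕ) + p + p)).natDegree ≤ 1 := by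
          compute_degree
          omega
        have := natDegree_mul_le_of_le h ih
        omega
    · simp [altRising_self_odd]
  | succ m ih =>
    cases n with
    | zero => simp [altRising]
    | succ n =>
      rw [altRising_left_succ, show p - ((m + 1 : ℕ) : ℚ[X]) + 1 = p - m by push_cast; ring]
      have h : (((n : ℚ[X]) + 1) * altRising (p - (m : ℚ[X])) p n).natDegree ≤ 0 + n / 2 :=
        natDegree_mul_le_of_le (by compute_degree) (ih n)
      exact (natDegree_add_le_of_degree_le (ih (n + 1)) (h.trans (by omega)))

section Condensation

open Matrix

variable {K : Type*} [Field K]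

lemma det_mul_det_toBlocks₂₂ {ι : Type*} [Fintype ι] [DecidableEq ι]
    (N : Matrix (Fin 2 ⊕ ι) (Fin 2 ⊕ ι) K) (hN : N.toBlocks₂₂.det ≠ 0) :
    N.det * N.toBlocks₂₂.det =
      (N.submatrix (Sum.map (fun _ : Unit => 0) id) (Sum.map (fun _ : Unit => 0) id)).det *
        (N.submatrix (Sum.map (fun _ : Unit => 1) id) (Sum.map (fun _ : Unit => 1) id)).det -
      (N.submatrix (Sum.map (fun _ : Unit => 1) id) (Sum.map (fun _ : Unit => 0) id)).det *
        (N.submatrix (Sum.map (fun _ : Unit => 0) id) (Sum.map (fun _ : Unit => 1) id)).det := by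
  have : Invertible N.toBlocks₂₂ :=
    N.toBlocks₂₂.invertibleOfIsUnitDet (isUnit_iff_ne_zero.2 hN)
  set s := N.toBlocks₁₁ - N.toBlocks₁₂ * ⅟N.toBlocks₂₂ * N.toBlocks₂₁
  have hminor (p q : Fin 2) :
      (N.submatrix (Sum.map (fun _ : Unit => p) id) (Sum.map (fun _ : Unit => q) id)).det =
        N.toBlocks₂₂.det * s p q := by
    have h : N.submatrix (Sum.map (fun _ : Unit => p) id) (Sum.map (fun _ : Unit => q) id) =
        fromBlocks (N.toBlocks₁₁.submatrix (fun _ => p) (fun _ => q))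
          (N.toBlocks₁₂.submatrix (fun _ => p) id) (N.toBlocks₂₁.submatrix id (fun _ => q))
          N.toBlocks₂₂ := by
      ext (i | i) (j | j) <;> rfl
    rw [h, det_fromBlocks₂₂, det_unique (n := Unit)]
    rfl
  have hdet : N.det = N.toBlocks₂₂.det * s.det := by
    conv_lhs => rw [← fromBlocks_toBlocks N]
    rw [det_fromBlocks₂₂]
  rw [hdet, det_fin_two, hminor, hminor, hminor, hminor]
  ring

/-- The Desnanot–Jacobi identity, when the interior minor does not vanish. -/
lemma det_mul_det_interior (n : ℕ) (M : Matrix (Fin (n + 2)) (Fin (n + 2)) K)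
    (hM : (M.submatrix (fun i : Fin n => i.succ.castSucc) fun j => j.succ.castSucc).det ≠ 0) :
    M.det * (M.submatrix (fun i : Fin n => i.succ.castSucc) fun j => j.succ.castSucc).det =
      (M.submatrix Fin.castSucc Fin.castSucc).det * (M.submatrix Fin.succ Fin.succ).det -
      (M.submatrix Fin.succ Fin.castSucc).det * (M.submatrix Fin.castSucc Fin.succ).det := by
  have hfirst : Function.Bijective (Sum.elim (fun _ : Unit => (0 : Fin (n + 1))) Fin.succ) := by
    rw [Fintype.bijective_iff_injective_and_card]
    refine ⟨?_, by simp [add_comm]⟩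
    rintro (i | i) (j | j) h <;> simp_all [Fin.ext_iff]
  have hlast : Function.Bijective
      (Sum.elim (fun _ : Unit => Fin.last n) (Fin.castSucc : Fin n → Fin (n + 1))) := by
    rw [Fintype.bijective_iff_injective_and_card]
    refine ⟨?_, by simp [add_comm]⟩
    rintro (i | i) (j | j) h <;> simp_all [Fin.ext_iff] <;> omega
  have hboth : Function.Bijective
      (Sum.elim ![(0 : Fin (n + 2)), Fin.last (n + 1)] fun i : Fin n => i.succ.castSucc) := by
    rw [Fintype.bijective_iff_injective_and_card]
    refine ⟨?_, by simp [add_comm]⟩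
    rintro (i | i) (j | j) h
    · fin_cases i <;> fin_cases j <;> simp_all [Fin.ext_iff]
    · fin_cases i <;> simp [Fin.ext_iff] at h; omega
    · fin_cases j <;> simp [Fin.ext_iff] at h; omega
    · simpa [Fin.ext_iff] using h
  set f := Equiv.ofBijective _ hfirst with hf
  set l := Equiv.ofBijective _ hlast with hl
  set e := Equiv.ofBijective _ hboth with he
  have h0 : e ∘ Sum.map (fun _ : Unit => 0) id = Fin.castSucc ∘ f := by
    ext (i | i) <;> simp [hf, he]
  have h1 : e ∘ Sum.map (fun _ : Unit => 1) id = Fin.succ ∘ l := by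
    ext (i | i) <;> simp [hl, he]
  have key := det_mul_det_toBlocks₂₂ (M.submatrix e e) hM
  simp only [submatrix_submatrix, h0, h1, det_submatrix_equiv_self] at key
  simp only [← submatrix_submatrix, det_submatrix_equiv_self] at key
  have hfl (A : Matrix (Fin (n + 1)) (Fin (n + 1)) K) :
      (A.submatrix f l).det = Equiv.Perm.sign (f.symm.trans l) * A.det := by
    rw [← det_permute', ← det_submatrix_equiv_self f (A.submatrix id _)]
    congr 1
    ext i j
    simp
  have hlf (A : Matrix (Fin (n + 1)) (Fin (n + 1)) K) :
      (A.submatrix l f).det = Equiv.Perm.sign (f.symm.trans l) * A.det := by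
    rw [← det_permute, ← det_submatrix_equiv_self f (A.submatrix _ id)]
    congr 1
    ext i j
    simp
  rw [hfl, hlf] at key
  refine key.trans ?_
  rcases Int.units_eq_one_or (Equiv.Perm.sign (f.symm.trans l)) with h | h <;> simp [h]

end Condensation

section polyDet

open Matrix

variable {R : Type*} [CommRing R]

/-- The entries of the matrix of `Edet` after clearing factorials from the rows and columns. -/
def polyEntry (x y : R) (i j : ℕ) : R :=
  rising (x + y + i) j * (y - x + 3 * j - 3 * i) * rising (x + 2 * i - j + 2) j *
    rising (y + 2 * j - i + 2) i

/-- The determinant of `Edet` after clearing factorials from the rows and columns. -/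
def polyDet (x y : R) (n : ℕ) : R := (of fun i j : Fin n => polyEntry x y i j).det

lemma map_polyDet {S : Type*} [CommRing S] (f : R →+* S) (x y : R) (n : ℕ) :
    f (polyDet x y n) = polyDet (f x) (f y) n := by
  rw [polyDet, polyDet, RingHom.map_det]
  congr 1
  ext i j
  simp [polyEntry, map_rising, map_ofNat]

lemma polyEntry_succ_succ (x y : R) (i j : ℕ) :
    polyEntry x y (i + 1) (j + 1) = ((x + y + i + 1) * (x + 2 * i + 3)) *
      ((y + 2 * j + 3) * polyEntry (x + 1) (y + 1) i j) := by
  simp only [polyEntry]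
  rw [rising_succ' _ j, rising_succ _ j, rising_succ _ i]
  push_cast
  ring_nf

lemma polyEntry_succ_left (x y : R) (i j : ℕ) :
    polyEntry x y (i + 1) j = (y + 2 * j + 1) * polyEntry (x + 2) (y - 1) i j := by
  simp only [polyEntry]
  rw [rising_succ _ i]
  push_cast
  ring_nf

lemma polyEntry_succ_right (x y : R) (i j : ℕ) :
    polyEntry x y i (j + 1) =
      ((x + y + i) * (x + 2 * i + 1)) * polyEntry (x - 1) (y + 2) i j := by
  simp only [polyEntry]
  rw [rising_succ' _ j, rising_succ _ j]
  push_cast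
  ring_nf

lemma det_of_mul_mul (u v : ℕ → R) (a : ℕ → ℕ → R) (n : ℕ) :
    (of fun i j : Fin n => u i * (v j * a i j)).det =
      (∏ i ∈ range n, u i * v i) * (of fun i j : Fin n => a i j).det := by
  refine (det_mul_column (fun i : Fin n => u i) (of fun i j : Fin n => v j * a i j)).trans ?_
  rw [Finset.prod_mul_distrib, Finset.prod_range, Finset.prod_range, mul_assoc]
  exact congrArg _ (det_mul_row (fun j : Fin n => v j) (of fun i j : Fin n => a i j))

lemma det_polyEntry_succ_succ (x y : R) (n : ℕ) :
    (of fun i j : Fin n => polyEntry x y (i + 1) (j + 1)).det =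
      (∏ i ∈ range n, (x + y + i + 1) * (x + 2 * i + 3) * (y + 2 * i + 3)) *
        polyDet (x + 1) (y + 1) n := by
  simp only [polyEntry_succ_succ]
  exact det_of_mul_mul (fun i => (x + y + i + 1) * (x + 2 * i + 3)) (fun j => y + 2 * j + 3) _ n

lemma det_polyEntry_succ_left (x y : R) (n : ℕ) :
    (of fun i j : Fin n => polyEntry x y (i + 1) j).det =
      (∏ i ∈ range n, (y + 2 * i + 1)) * polyDet (x + 2) (y - 1) n := by
  simpa only [polyDet, polyEntry_succ_left, one_mul] using
    det_of_mul_mul (fun _ => 1) (fun j => y + 2 * j + 1) (polyEntry (x + 2) (y - 1)) n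

lemma det_polyEntry_succ_right (x y : R) (n : ℕ) :
    (of fun i j : Fin n => polyEntry x y i (j + 1)).det =
      (∏ i ∈ range n, (x + y + i) * (x + 2 * i + 1)) * polyDet (x - 1) (y + 2) n := by
  simpa only [polyDet, polyEntry_succ_right, one_mul, mul_one] using
    det_of_mul_mul (fun i => (x + y + i) * (x + 2 * i + 1)) (fun _ => 1)
      (polyEntry (x - 1) (y + 2)) n

lemma polyDet_condensation {K : Type*} [Field K] (x y : K) (n : ℕ)
    (h : (∏ i ∈ range n, (x + y + i + 1) * (x + 2 * i + 3) * (y + 2 * i + 3)) *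
        polyDet (x + 1) (y + 1) n ≠ 0) :
    polyDet x y (n + 2) *
        ((∏ i ∈ range n, (x + y + i + 1) * (x + 2 * i + 3) * (y + 2 * i + 3)) *
          polyDet (x + 1) (y + 1) n) =
      polyDet x y (n + 1) *
        ((∏ i ∈ range (n + 1), (x + y + i + 1) * (x + 2 * i + 3) * (y + 2 * i + 3)) *
          polyDet (x + 1) (y + 1) (n + 1)) -
      ((∏ i ∈ range (n + 1), (y + 2 * i + 1)) * polyDet (x + 2) (y - 1) (n + 1)) *
        ((∏ i ∈ range (n + 1), (x + y + i) * (x + 2 * i + 1)) *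
          polyDet (x - 1) (y + 2) (n + 1)) := by
  rw [← det_polyEntry_succ_succ] at h
  rw [← det_polyEntry_succ_succ, ← det_polyEntry_succ_succ, ← det_polyEntry_succ_left,
    ← det_polyEntry_succ_right]
  exact det_mul_det_interior n (of fun i j => polyEntry x y i j) h

/-- The closed form of `polyDet`. -/
def polyDetValue (x y : R) (n : ℕ) : R :=
  (∏ i ∈ range n, (i.factorial : R) * rising (2 * x + y + 2 * i + 1) i *
    rising (x + 2 * y + 2 * i + 1) i) * altRising x y n

lemma map_polyDetValue {S : Type*} [CommRing S] (f : R →+* S) (x y : R) (n : ℕ) :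
    f (polyDetValue x y n) = polyDetValue (f x) (f y) n := by
  simp [polyDetValue, map_rising, map_altRising, map_ofNat]

lemma polyDetValue_pos {x y : ℚ} (h1 : 0 < x) (h2 : x < y) (n : ℕ) :
    0 < polyDetValue x y n := by
  have h3 : 0 < y := h1.trans h2
  refine mul_pos (Finset.prod_pos fun i _ => ?_) (altRising_pos h1 h2 n)
  have := rising_pos (a := 2 * x + y + 2 * i + 1) (by positivity) i
  have := rising_pos (a := x + 2 * y + 2 * i + 1) (by positivity) i
  positivity

lemma prod_mul_prod_shift (x y : R) (n : ℕ) :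
    (∏ i ∈ range (n + 1), (y + 2 * i + 1)) * ∏ i ∈ range (n + 1), (x + y + i) * (x + 2 * i + 1) =
      (x + 1) * (y + 1) * (x + y) *
        ∏ i ∈ range n, (x + y + i + 1) * (x + 2 * i + 3) * (y + 2 * i + 3) := by
  rw [← Finset.prod_mul_distrib, Finset.prod_range_succ', mul_comm]
  congr 1
  · push_cast; ring
  · exact Finset.prod_congr rfl fun i _ => by push_cast; ring

lemma prod_rising_mul_prod_rising (u : R) (n : ℕ) :
    (∏ i ∈ range (n + 2), rising (u + 2 * i + 1) i) *
        ∏ i ∈ range n, rising (u + 3 + 2 * i + 1) i =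
      (u + 2 * n + 3) * ((∏ i ∈ range (n + 1), rising (u + 2 * i + 1) i) *
        ∏ i ∈ range (n + 1), rising (u + 3 + 2 * i + 1) i) := by
  rw [Finset.prod_range_succ _ (n + 1), Finset.prod_range_succ _ n, Finset.prod_range_succ _ n,
    rising_succ', show u + 2 * ((n + 1 : ℕ) : R) + 1 = u + 2 * n + 3 by push_cast; ring,
    show u + 2 * (n : R) + 3 + 1 = u + 3 + 2 * n + 1 by ring]
  ring

lemma polyDetValue_condensation (x y : R) (n : ℕ) :
    polyDetValue x y (n + 2) *
        ((∏ i ∈ range n, (x + y + i + 1) * (x + 2 * i + 3) * (y + 2 * i + 3)) *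
          polyDetValue (x + 1) (y + 1) n) =
      polyDetValue x y (n + 1) *
        ((∏ i ∈ range (n + 1), (x + y + i + 1) * (x + 2 * i + 3) * (y + 2 * i + 3)) *
          polyDetValue (x + 1) (y + 1) (n + 1)) -
      ((∏ i ∈ range (n + 1), (y + 2 * i + 1)) * polyDetValue (x + 2) (y - 1) (n + 1)) *
        ((∏ i ∈ range (n + 1), (x + y + i) * (x + 2 * i + 1)) *
          polyDetValue (x - 1) (y + 2) (n + 1)) := by
  have hu := prod_rising_mul_prod_rising (2 * x + y) n
  have hv := prod_rising_mul_prod_rising (x + 2 * y) n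
  have hp := prod_mul_prod_shift x y n
  have hf : (∏ i ∈ range (n + 2), (i.factorial : R)) * ∏ i ∈ range n, (i.factorial : R) =
      (n + 1) * (∏ i ∈ range (n + 1), (i.factorial : R)) ^ 2 := by
    rw [Finset.prod_range_succ _ (n + 1), Finset.prod_range_succ _ n, Nat.factorial_succ]
    push_cast
    ring
  simp only [polyDetValue, Finset.prod_mul_distrib (f := fun i : ℕ => _ * rising _ i),
    Finset.prod_mul_distrib (f := fun i : ℕ => (i.factorial : R))]
  rw [show 2 * (x + 1) + (y + 1) = 2 * x + y + 3 by ring,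
    show x + 1 + 2 * (y + 1) = x + 2 * y + 3 by ring,
    show 2 * (x + 2) + (y - 1) = 2 * x + y + 3 by ring,
    show x + 2 + 2 * (y - 1) = x + 2 * y by ring,
    show 2 * (x - 1) + (y + 2) = 2 * x + y by ring,
    show x - 1 + 2 * (y + 2) = x + 2 * y + 3 by ring,
    Finset.prod_range_succ (fun i : ℕ => (x + y + i + 1) * (x + 2 * i + 3) * (y + 2 * i + 3)) n]
  generalize (∏ i ∈ range (n + 2), rising (2 * x + y + 2 * (i : R) + 1) i) = U₂ at *
  generalize (∏ i ∈ range (n + 1), rising (2 * x + y + 2 * (i : R) + 1) i) = U₁ at *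
  generalize (∏ i ∈ range n, rising (2 * x + y + 3 + 2 * (i : R) + 1) i) = U₀' at *
  generalize (∏ i ∈ range (n + 1), rising (2 * x + y + 3 + 2 * (i : R) + 1) i) = U₁' at *
  generalize (∏ i ∈ range (n + 2), rising (x + 2 * y + 2 * (i : R) + 1) i) = V₂ at *
  generalize (∏ i ∈ range (n + 1), rising (x + 2 * y + 2 * (i : R) + 1) i) = V₁ at *
  generalize (∏ i ∈ range n, rising (x + 2 * y + 3 + 2 * (i : R) + 1) i) = V₀' at *
  generalize (∏ i ∈ range (n + 1), rising (x + 2 * y + 3 + 2 * (i : R) + 1) i) = V₁' at *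
  generalize (∏ i ∈ range (n + 2), (i.factorial : R)) = F₂ at *
  generalize (∏ i ∈ range (n + 1), (i.factorial : R)) = F₁ at *
  generalize (∏ i ∈ range n, (i.factorial : R)) = F₀ at *
  generalize (∏ i ∈ range (n + 1), (y + 2 * (i : R) + 1)) = p at *
  generalize (∏ i ∈ range (n + 1), (x + y + i) * (x + 2 * (i : R) + 1)) = q at *
  generalize (∏ i ∈ range n, (x + y + i + 1) * (x + 2 * (i : R) + 3) * (y + 2 * i + 3)) = r at *
  have hs := altRising_condensation x y n
  generalize altRising x y (n + 2) = s₂ at *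
  generalize altRising x y (n + 1) = s₁ at *
  generalize altRising (x + 1) (y + 1) n = t₀ at *
  generalize altRising (x + 1) (y + 1) (n + 1) = t₁ at *
  generalize altRising (x + 2) (y - 1) (n + 1) = c at *
  generalize altRising (x - 1) (y + 2) (n + 1) = d at *
  calc _ = (F₂ * F₀) * (U₂ * U₀') * (V₂ * V₀') * r * (s₂ * t₀) := by ring
    _ = F₁ ^ 2 * (U₁ * U₁') * (V₁ * V₁') * r * ((n + 1) * (2 * x + y + 2 * n + 3) *
        (x + 2 * y + 2 * n + 3) * (s₂ * t₀)) := by rw [hf, hu, hv]; ring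
    _ = F₁ ^ 2 * (U₁ * U₁') * (V₁ * V₁') * r * ((x + y + n + 1) * (x + 2 * n + 3) *
        (y + 2 * n + 3) * (s₁ * t₁)) - F₁ ^ 2 * (U₁ * U₁') * (V₁ * V₁') *
        ((x + 1) * (y + 1) * (x + y) * r) * (c * d) := by rw [hs]; ring
    _ = _ := by rw [← hp]; ring

lemma polyDet_eq_of_large (n : ℕ) (x y : ℚ) (hx : n < x) (hy : x + 3 * n < y) :
    polyDet x y n = polyDetValue x y n := by
  induction n using Nat.twoStepInduction generalizing x y with
  | zero => simp [polyDet, polyDetValue, altRising]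
  | one => simp [polyDet, polyDetValue, altRising, polyEntry, rising]
  | more n ih1 ih2 =>
    push_cast at hx hy
    have hn : (0 : ℚ) ≤ n := n.cast_nonneg
    have hx0 : 0 < x := by linarith
    have hy0 : 0 < y := by linarith
    have hne : (∏ i ∈ range n, (x + y + i + 1) * (x + 2 * i + 3) * (y + 2 * i + 3)) *
        polyDetValue (x + 1) (y + 1) n ≠ 0 :=
      mul_ne_zero (Finset.prod_ne_zero_iff.2 fun i _ => by positivity)
        (polyDetValue_pos (by linarith) (by linarith) n).ne'
    have h0 := ih1 (x + 1) (y + 1) (by linarith) (by linarith)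
    have key := polyDet_condensation x y n (by rwa [h0])
    rw [h0, ih2 x y (by push_cast; linarith) (by push_cast; linarith),
      ih2 (x + 1) (y + 1) (by push_cast; linarith) (by push_cast; linarith),
      ih2 (x + 2) (y - 1) (by push_cast; linarith) (by push_cast; linarith),
      ih2 (x - 1) (y + 2) (by push_cast; linarith) (by push_cast; linarith),
      ← polyDetValue_condensation] at key
    exact mul_right_cancel₀ hne key

open Polynomial in
lemma eval_polyDet (p q : R[X]) (n : ℕ) (a : R) :
    (polyDet p q n).eval a = polyDet (p.eval a) (q.eval a) n :=
  map_polyDet (evalRingHom a) p q n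

open Polynomial in
lemma eval_polyDetValue (p q : R[X]) (n : ℕ) (a : R) :
    (polyDetValue p q n).eval a = polyDetValue (p.eval a) (q.eval a) n :=
  map_polyDetValue (evalRingHom a) p q n

open Polynomial in
theorem polyDet_eq (n : ℕ) (x y : ℚ) : polyDet x y n = polyDetValue x y n := by
  have hy (x y : ℚ) (hx : n < x) : polyDet x y n = polyDetValue x y n := by
    have h : polyDet (C x) (X : ℚ[X]) n = polyDetValue (C x) X n := by
      refine eq_of_infinite_eval_eq _ _ ((Set.Ioi_infinite (x + 3 * n)).mono fun y hy => ?_)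
      have := polyDet_eq_of_large n x y hx hy
      simpa [eval_polyDet, eval_polyDetValue] using this
    simpa [eval_polyDet, eval_polyDetValue] using congrArg (eval y) h
  have h : polyDet (X : ℚ[X]) (C y) n = polyDetValue X (C y) n := by
    refine eq_of_infinite_eval_eq _ _ ((Set.Ioi_infinite (n : ℚ)).mono fun x hx => ?_)
    have := hy x y hx
    simpa [eval_polyDet, eval_polyDetValue] using this
  simpa [eval_polyDet, eval_polyDetValue] using congrArg (eval x) h

end polyDet

lemma rfac_natCast_add (N j : ℕ) : rfac (N + j) = N.factorial * rising (N + 1 : ℚ) j := by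
  induction j with
  | zero => simp [rfac, rising]
  | succ j ih =>
    rw [rising_succ, ← mul_assoc, ← ih, rfac, rfac, if_pos (by positivity), if_pos (by positivity),
      show ((N : ℤ) + (j + 1 : ℕ)).toNat = N + j + 1 by omega,
      show ((N : ℤ) + (j : ℕ)).toNat = N + j by omega, Nat.factorial_succ]
    push_cast
    ring

lemma rfacInv_sub_one (k : ℤ) : rfacInv (k - 1) = k * rfacInv k := by
  rcases lt_trichotomy k 0 with h | rfl | h
  · simp [rfacInv, show ¬ 1 ≤ k by omega, show ¬ 0 ≤ k by omega]
  · simp [rfacInv]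
  · obtain ⟨l, rfl⟩ : ∃ l : ℕ, k = l + 1 := ⟨(k - 1).toNat, by omega⟩
    rw [rfacInv, rfacInv, if_pos (by omega), if_pos (by omega),
      show ((l : ℤ) + 1 - 1).toNat = l by omega, show ((l : ℤ) + 1).toNat = l + 1 by omega,
      Nat.factorial_succ]
    push_cast
    field_simp

lemma rfacInv_natCast_sub (N j : ℕ) :
    rfacInv (N - j) = rising (N - j + 1 : ℚ) j * (N.factorial : ℚ)⁻¹ := by
  induction j with
  | zero => simp [rfacInv, rising]
  | succ j ih =>
    rw [show (N : ℤ) - (j + 1 : ℕ) = N - j - 1 by push_cast; ring, rfacInv_sub_one, ih,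
      rising_succ']
    push_cast
    ring_nf

lemma Edet_eq (x y n : ℕ) (h : 1 ≤ x + y) :
    Edet x y n = (∏ i ∈ range n, ((x + y + i - 1).factorial : ℚ) /
      ((x + 2 * i + 1).factorial * (y + 2 * i + 1).factorial)) * polyDet (x : ℚ) y n := by
  have hentry (i j : ℕ) : rfac ((x : ℤ) + (y : ℤ) + i + j - 1) *
      (((y : ℤ) - (x : ℤ) + 3 * (j : ℤ) - 3 * (i : ℤ)) : ℚ) *
      rfacInv ((x : ℤ) + 2 * i - j + 1) * rfacInv ((y : ℤ) + 2 * j - i + 1) =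
      ((x + y + i - 1).factorial * ((x + 2 * i + 1).factorial : ℚ)⁻¹) *
        (((y + 2 * j + 1).factorial : ℚ)⁻¹ * polyEntry (x : ℚ) y i j) := by
    have h1 : (x : ℤ) + y + i + j - 1 = (x + y + i - 1 : ℕ) + j := by omega
    have h2 : (x : ℤ) + 2 * i - j + 1 = (x + 2 * i + 1 : ℕ) - j := by push_cast; ring
    have h3 : (y : ℤ) + 2 * j - i + 1 = (y + 2 * j + 1 : ℕ) - i := by push_cast; ring
    have h4 : ((x + y + i - 1 : ℕ) : ℚ) + 1 = x + y + i := by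
      have : x + y + i - 1 + 1 = x + y + i := by omega
      exact_mod_cast this
    rw [h1, h2, h3, rfac_natCast_add, rfacInv_natCast_sub, rfacInv_natCast_sub, h4, polyEntry]
    push_cast
    ring_nf
  rw [Edet]
  simp only [hentry]
  refine (det_of_mul_mul
    (fun i => (x + y + i - 1).factorial * ((x + 2 * i + 1).factorial : ℚ)⁻¹)
    (fun j => ((y + 2 * j + 1).factorial : ℚ)⁻¹) (polyEntry (x : ℚ) y) n).trans ?_
  rw [polyDet]
  congr 1
  exact Finset.prod_congr rfl fun i _ => by rw [div_eq_mul_inv, mul_inv, mul_assoc]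

open Polynomial in
lemma exists_altRising_eq_poch_mul (m n : ℕ) (hmn : m ≤ n) :
    ∃ Q : ℚ[X], Q.natDegree ≤ m / 2 ∧ ∀ x : ℚ,
      altRising x (x + m) n = poch (x + m) (n / 2 - m / 2) * Q.eval x := by
  have hmonic (k : ℕ) : (rising (X + (m : ℚ[X])) k).Monic ∧
      (rising (X + (m : ℚ[X])) k).natDegree = k := by
    induction k with
    | zero => simp [rising]
    | succ k ih =>
      have h : X + (m : ℚ[X]) + (k : ℚ[X]) = X + C ((m : ℚ) + k) := by simp [add_assoc]
      rw [rising_succ, h]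
      exact ⟨ih.1.mul (monic_X_add_C _), by
        rw [ih.1.natDegree_mul (monic_X_add_C _), ih.2, natDegree_X_add_C]⟩
  obtain ⟨Q, hQ⟩ := (rising_dvd_rising (X + (m : ℚ[X])) (show n / 2 - m / 2 ≤ (n + 1 - m) / 2 by
    omega)).trans (rising_dvd_altRising (X + (m : ℚ[X])) m n)
  refine ⟨Q, ?_, fun x => ?_⟩
  · rcases eq_or_ne Q 0 with rfl | hQ0
    · simp
    have hdeg := natDegree_altRising_le (X + (m : ℚ[X])) (by compute_degree) m n
    rw [hQ, (hmonic _).1.natDegree_mul' hQ0, (hmonic _).2] at hdeg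
    omega
  · have := congrArg (evalRingHom x) hQ
    rw [map_mul, map_altRising, map_rising] at this
    simpa [rising, poch] using this

/-- Proposition 5: for fixed `m ≤ n`, a polynomial factor of degree at most `⌊m/2⌋`. -/
theorem prop5 (m n : ℕ) (hmn : m ≤ n) :
    ∃ P : Polynomial ℚ, P.natDegree ≤ m / 2 ∧
      ∀ x : ℕ, 1 ≤ x + m →
        Edet x (x + m) n =
          (∏ i ∈ Finset.range n,
            ((Nat.factorial (2 * x + m + i - 1) : ℚ) *
                poch (3 * x + m + 2 * i + 1 : ℚ) i * poch (3 * x + 2 * m + 2 * i + 1 : ℚ) i /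
              ((Nat.factorial (x + 2 * i + 1) : ℚ) * (Nat.factorial (x + m + 2 * i + 1) : ℚ)))) *
          poch (x + m : ℚ) (n / 2 - m / 2) * P.eval (x : ℚ) := by
  obtain ⟨Q, hQ, hQeval⟩ := exists_altRising_eq_poch_mul m n hmn
  refine ⟨Polynomial.C (∏ i ∈ range n, (i.factorial : ℚ)) * Q,
    (Polynomial.natDegree_C_mul_le _ _).trans hQ, fun x hx => ?_⟩
  rw [Edet_eq x (x + m) n (by omega), polyDet_eq, polyDetValue, Nat.cast_add, hQeval,
    Polynomial.eval_mul, Polynomial.eval_C, ← mul_assoc, ← Finset.prod_mul_distrib,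
    ← mul_assoc, ← mul_assoc _ (∏ i ∈ range n, (i.factorial : ℚ)),
    mul_right_comm _ _ (∏ i ∈ range n, (i.factorial : ℚ)),
    ← Finset.prod_mul_distrib]
  congr 2
  refine Finset.prod_congr rfl fun i _ => ?_
  rw [show 2 * (x : ℚ) + (x + m) = 3 * x + m by ring,
    show (x : ℚ) + 2 * (x + m) = 3 * x + 2 * m by ring,
    show x + (x + m) + i - 1 = 2 * x + m + i - 1 by omega]
  simp only [poch, rising]
  ring
end

section
/- Let x be a nonnegative integer and n a positive integer. If n is even then S(x,n) = ∏_{i=0}^{n−1} (3x+3i+1)! / ((3x+2i+1)! · (x+2i)!) · ∏_{i=0}^{(n−2)/2} (2x+2i+1)! · (2i)!, and if n is odd then S(x,n) = 2^x · ∏_{i=1}^{n−1} (3x+3i+1)! / ((3x+2i+1)! · (x+2i)!) · ∏_{i=1}^{(n−1)/2} (2x+2i)! · (2i−1)!. (Theorem 11; this proves the Robbins–Zeilberger conjecture and generalizes the count of totally symmetric self-complementary plane partitions) -/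
open Finset

open scoped Classical

/-- The binomial coefficient `C(N,r)` for integers, equal to `0` for `r < 0` or `r > N`. -/
def ibinom (N r : ℤ) : ℤ := if 0 ≤ r ∧ r ≤ N then ((N.toNat).choose r.toNat : ℤ) else 0

/-- `S(x,n)`: the sum of all `n×n` minors of the `n×(2n+x-1)` matrix with entries
`C(x+i, j-i)`, i.e. the sum over strictly increasing `λ : Fin n → Fin (2n+x-1)` of
`det (C(x+i, λ_j - i))`. -/
noncomputable def Sminor (x n : ℕ) : ℤ :=
  ∑ f : Fin n → Fin (2 * n + x - 1),
    if StrictMono f then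
      Matrix.det (Matrix.of fun i j : Fin n =>
        ibinom ((x : ℤ) + (i : ℕ)) ((((f j : ℕ) : ℤ)) - ((i : ℕ) : ℤ)))
    else 0

theorem det_cons_eq_sum {R : Type*} [CommRing R] {m : ℕ} (r : Fin (m + 1) → R)
    (B : Fin m → Fin (m + 1) → R) :
    (Matrix.of (Fin.cons r B : Fin (m + 1) → Fin (m + 1) → R)).det =
      ∑ j : Fin (m + 1), (-1) ^ (j : ℕ) * (Matrix.of fun i k => B i (j.succAbove k)).det * r j := by
  rw [Matrix.det_succ_row_zero]
  refine Finset.sum_congr rfl fun j _ => ?_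
  simp only [Matrix.of_apply, Fin.cons_zero]
  rw [mul_right_comm]
  congr 2

theorem det_condensation {R : Type*} [CommRing R] (a : ℕ → ℕ → R) (m : ℕ) :
    (Matrix.of fun i j : Fin (m + 2) => a i j).det *
        (Matrix.of fun i j : Fin m => a (i + 1) (j + 1)).det =
      (Matrix.of fun i j : Fin (m + 1) => a i j).det *
          (Matrix.of fun i j : Fin (m + 1) => a (i + 1) (j + 1)).det -
        (Matrix.of fun i j : Fin (m + 1) => a (i + 1) j).det *
          (Matrix.of fun i j : Fin (m + 1) => a i (j + 1)).det := by
  set A : Matrix (Fin (m + 2)) (Fin (m + 2)) R := Matrix.of fun i j => a i j with hA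
  set B : Fin m → Fin (m + 1) → R := fun i j => a (i + 1) j with hB
  set v : Fin (m + 1) → R := fun j =>
    (-1) ^ (j : ℕ) * (Matrix.of fun i k => B i (j.succAbove k)).det with hv
  have hsum : ∀ i : Fin (m + 2), ∑ j, (Fin.snoc v 0 : Fin (m + 2) → R) j • A i j =
      (Matrix.of (Fin.cons (fun j : Fin (m + 1) => a i j) B :
        Fin (m + 1) → Fin (m + 1) → R)).det := by
    intro i
    rw [Fin.sum_univ_castSucc, det_cons_eq_sum]
    simp [hv, hA]
  have h0 : (Matrix.of (Fin.cons (fun j : Fin (m + 1) => a 0 j) B :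
        Fin (m + 1) → Fin (m + 1) → R)).det = (Matrix.of fun i j : Fin (m + 1) => a i j).det := by
    congr 1
    ext i j
    refine Fin.cases ?_ (fun i => ?_) i <;> simp [hB]
  have hmid : ∀ i : Fin m, (Matrix.of (Fin.cons (fun j : Fin (m + 1) => a (i + 1) j) B :
        Fin (m + 1) → Fin (m + 1) → R)).det = 0 := by
    intro i
    refine Matrix.det_zero_of_row_eq (i := 0) (j := i.succ) (Fin.succ_ne_zero i).symm ?_
    ext j
    simp [hB]
  have hlast : (Matrix.of (Fin.cons (fun j : Fin (m + 1) => a (m + 1) j) B :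
        Fin (m + 1) → Fin (m + 1) → R)).det =
      (-1) ^ m * (Matrix.of fun i j : Fin (m + 1) => a (i + 1) j).det := by
    rw [det_cons_eq_sum, Matrix.det_succ_row _ (Fin.last m), Finset.mul_sum]
    refine Finset.sum_congr rfl fun j _ => ?_
    have e : (Matrix.of fun (i : Fin m) (k : Fin m) => B i (j.succAbove k)) =
      (Matrix.of fun i j : Fin (m + 1) => a (i + 1) j).submatrix
        (Fin.last m).succAbove j.succAbove := by
      ext i k
      simp [hB]
    rw [e]
    simp only [Fin.val_last, Matrix.of_apply, pow_add]
    have : ((-1 : R) ^ m) * (-1) ^ m = 1 := by rw [← mul_pow]; simp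
    linear_combination (-(-1) ^ (j : ℕ) * a (m + 1) j * (Matrix.submatrix
      (Matrix.of fun i j : Fin (m + 1) => a (i + 1) j) (Fin.last m).succAbove j.succAbove).det) *
      this
  have hvz : (Fin.snoc v 0 : Fin (m + 2) → R) 0 =
      (Matrix.of fun i j : Fin m => a (i + 1) (j + 1)).det := by
    have : (0 : Fin (m + 2)) = Fin.castSucc 0 := rfl
    rw [this, Fin.snoc_castSucc]
    simp [hv, hB]
  have key := Matrix.det_updateCol_sum A 0 (Fin.snoc v 0 : Fin (m + 2) → R)
  rw [hvz, smul_eq_mul, mul_comm] at key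
  rw [← key, Matrix.det_succ_column_zero, Fin.sum_univ_succ, Fin.sum_univ_castSucc]
  rw [Finset.sum_eq_zero]
  · simp only [Matrix.updateCol_self, hsum]
    have e1 : (A.updateCol 0 fun i => (Matrix.of (Fin.cons (fun j : Fin (m + 1) => a i j) B :
        Fin (m + 1) → Fin (m + 1) → R)).det).submatrix (Fin.succAbove 0) Fin.succ =
        Matrix.of fun i j : Fin (m + 1) => a (i + 1) (j + 1) := by
      ext i j
      simp [hA]
    have e2 : (A.updateCol 0 fun i => (Matrix.of (Fin.cons (fun j : Fin (m + 1) => a i j) B :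
        Fin (m + 1) → Fin (m + 1) → R)).det).submatrix (Fin.succAbove (Fin.last m).succ) Fin.succ =
        Matrix.of fun i j : Fin (m + 1) => a i (j + 1) := by
      ext i j
      simp [hA]
    rw [e1, e2]
    simp only [Fin.val_zero, Fin.succ_last, Fin.val_last, h0, hlast]
    have : ((-1 : R) ^ m) * (-1) ^ m = 1 := by rw [← mul_pow]; simp
    rw [pow_succ]
    linear_combination (-(Matrix.of fun i j : Fin (m + 1) => a (i + 1) j).det *
          (Matrix.of fun i j : Fin (m + 1) => a i (j + 1)).det) * this
  · intro i _
    simp only [Matrix.updateCol_self, hsum]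
    have := hmid i
    simp only [Fin.val_succ, Fin.val_castSucc, this]
    ring

/-- The rising factorial `z (z+1) ⋯ (z+k-1)`. -/
def risingFac (z : ℚ) (k : ℕ) : ℚ := ∏ t ∈ range k, (z + t)

/-- The falling factorial `z (z-1) ⋯ (z-k+1)`. -/
def fallingFac (z : ℚ) (k : ℕ) : ℚ := ∏ t ∈ range k, (z - t)

theorem risingFac_succ (z : ℚ) (k : ℕ) : risingFac z (k + 1) = risingFac z k * (z + k) :=
  prod_range_succ _ _

theorem risingFac_succ' (z : ℚ) (k : ℕ) : risingFac z (k + 1) = z * risingFac (z + 1) k := by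
  simp only [risingFac, prod_range_succ', mul_comm z]
  congr 1
  · refine prod_congr rfl fun t _ => ?_
    push_cast; ring
  · simp

theorem risingFac_pos {z : ℚ} (hz : 0 < z) (k : ℕ) : 0 < risingFac z k :=
  prod_pos fun t _ => by positivity

theorem fallingFac_succ' (z : ℚ) (k : ℕ) : fallingFac z (k + 1) = z * fallingFac (z - 1) k := by
  simp only [fallingFac, prod_range_succ', mul_comm z]
  congr 1
  · refine prod_congr rfl fun t _ => ?_
    push_cast; ring
  · simp

/-- The entries `(X+Y)_{i+j} (X+2i)^{↓j} (Y+2j)^{↓i}`; up to row and column factors these are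
`(X+Y+i+j-1)! / ((X+2i-j)! (Y+2j-i)!)`. -/
def hyperEntry (X Y : ℚ) (i j : ℕ) : ℚ :=
  risingFac (X + Y) (i + j) * fallingFac (X + 2 * i) j * fallingFac (Y + 2 * j) i

/-- The value of the determinant of `hyperEntry X Y`. -/
def hyperProd (X Y : ℚ) (n : ℕ) : ℚ :=
  ∏ i ∈ range n, (i.factorial * risingFac (X + Y) i * risingFac (2 * X + Y + 2 * i) i *
    risingFac (X + 2 * Y + 2 * i) i)

theorem hyperProd_succ (X Y : ℚ) (n : ℕ) : hyperProd X Y (n + 1) = hyperProd X Y n *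
    (n.factorial * risingFac (X + Y) n * risingFac (2 * X + Y + 2 * n) n *
      risingFac (X + 2 * Y + 2 * n) n) :=
  prod_range_succ _ _

theorem hyperProd_pos {X Y : ℚ} (h₁ : 0 < 2 * X + Y) (h₂ : 0 < X + 2 * Y) (n : ℕ) :
    0 < hyperProd X Y n := by
  refine prod_pos fun i _ => ?_
  have := risingFac_pos (z := X + Y) (by linarith) i
  have := risingFac_pos (z := 2 * X + Y + 2 * i) (by positivity) i
  have := risingFac_pos (z := X + 2 * Y + 2 * i) (by positivity) i
  positivity

theorem det_hyperEntry_succ_succ (X Y : ℚ) (m : ℕ) :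
    (Matrix.of fun i j : Fin m => hyperEntry X Y (i + 1) (j + 1)).det =
      (∏ i ∈ range m, ((X + Y) * (X + Y + 1) * (X + 2 * i + 2))) *
        (∏ j ∈ range m, (Y + 2 * j + 2)) *
        (Matrix.of fun i j : Fin m => hyperEntry (X + 1) (Y + 1) i j).det := by
  rw [← Fin.prod_univ_eq_prod_range (fun i => (X + Y) * (X + Y + 1) * (X + 2 * (i : ℚ) + 2)),
    ← Fin.prod_univ_eq_prod_range (fun j => Y + 2 * (j : ℚ) + 2), mul_assoc,
    ← Matrix.det_mul_row, ← Matrix.det_mul_column]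
  congr 1
  ext i j
  simp only [Matrix.of_apply, hyperEntry]
  rw [show (i : ℕ) + 1 + (j + 1) = i + j + 1 + 1 by ring, risingFac_succ', risingFac_succ',
    fallingFac_succ', fallingFac_succ']
  push_cast
  ring_nf

theorem det_hyperEntry_succ_left (X Y : ℚ) (m : ℕ) :
    (Matrix.of fun i j : Fin m => hyperEntry X Y (i + 1) j).det =
      (∏ j ∈ range m, ((X + Y) * (Y + 2 * j))) *
        (Matrix.of fun i j : Fin m => hyperEntry (X + 2) (Y - 1) i j).det := by
  rw [← Fin.prod_univ_eq_prod_range (fun j => (X + Y) * (Y + 2 * (j : ℚ))),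
    ← Matrix.det_mul_row]
  congr 1
  ext i j
  simp only [Matrix.of_apply, hyperEntry]
  rw [show (i : ℕ) + 1 + j = i + j + 1 by ring, risingFac_succ', fallingFac_succ']
  push_cast
  ring_nf

theorem det_hyperEntry_succ_right (X Y : ℚ) (m : ℕ) :
    (Matrix.of fun i j : Fin m => hyperEntry X Y i (j + 1)).det =
      (∏ i ∈ range m, ((X + Y) * (X + 2 * i))) *
        (Matrix.of fun i j : Fin m => hyperEntry (X - 1) (Y + 2) i j).det := by
  rw [← Fin.prod_univ_eq_prod_range (fun j => (X + Y) * (X + 2 * (j : ℚ))),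
    ← Matrix.det_mul_column]
  congr 1
  ext i j
  simp only [Matrix.of_apply, hyperEntry]
  rw [show (i : ℕ) + (j + 1) = i + j + 1 by ring, risingFac_succ', fallingFac_succ']
  push_cast
  ring_nf

theorem hyperProd_shift {X Y : ℚ} (h : 0 < X + Y) (n : ℕ) :
    (X + Y + n) * (hyperProd (X + 2) (Y - 1) n * hyperProd (X - 1) (Y + 2) n) * (X + Y) ^ n =
      hyperProd X Y n * hyperProd (X + 1) (Y + 1) n * (X + Y + 1) ^ n * (X + Y) := by
  induction n with
  | zero => simp [hyperProd]
  | succ n ih =>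
    have hn : X + Y + n ≠ 0 := by positivity
    apply mul_left_cancel₀ hn
    simp only [hyperProd_succ]
    rw [show X + 2 + (Y - 1) = X + Y + 1 by ring, show X - 1 + (Y + 2) = X + Y + 1 by ring,
      show X + 1 + (Y + 1) = X + Y + 1 + 1 by ring,
      show 2 * (X + 2) + (Y - 1) + 2 * (n : ℚ) = 2 * (X + 1) + (Y + 1) + 2 * n by ring,
      show X + 2 + 2 * (Y - 1) + 2 * (n : ℚ) = X + 2 * Y + 2 * n by ring,
      show 2 * (X - 1) + (Y + 2) + 2 * (n : ℚ) = 2 * X + Y + 2 * n by ring,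
      show X - 1 + 2 * (Y + 2) + 2 * (n : ℚ) = X + 1 + 2 * (Y + 1) + 2 * n by ring]
    have r1 : risingFac (X + Y) n * (X + Y + n) = (X + Y) * risingFac (X + Y + 1) n := by
      rw [← risingFac_succ, risingFac_succ']
    have r2 : risingFac (X + Y + 1) n * (X + Y + 1 + n) =
        (X + Y + 1) * risingFac (X + Y + 1 + 1) n := by
      rw [← risingFac_succ, risingFac_succ']
    push_cast
    set a := risingFac (X + Y) n
    set b := risingFac (X + Y + 1) n
    set c := risingFac (X + Y + 1 + 1) n
    set F := ((n.factorial : ℚ)) ^ 2 * risingFac (2 * (X + 1) + (Y + 1) + 2 * n) n *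
      risingFac (X + 2 * Y + 2 * n) n * risingFac (2 * X + Y + 2 * n) n *
      risingFac (X + 1 + 2 * (Y + 1) + 2 * n) n with hF
    have r3 : b ^ 2 * (X + Y) * (X + Y + 1 + n) = a * c * (X + Y + n) * (X + Y + 1) := by
      linear_combination (b * (X + Y)) * r2 - (X + Y + 1) * c * r1
    rw [pow_succ, pow_succ]
    linear_combination (F * b ^ 2 * (X + Y) * (X + Y + 1 + n)) * ih +
      (F * hyperProd X Y n * hyperProd (X + 1) (Y + 1) n * (X + Y + 1) ^ n * (X + Y)) * r3

theorem hyperProd_condensation {X Y : ℚ} (h : 0 < X + Y) (m : ℕ) :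
    hyperProd X Y (m + 2) * ((∏ i ∈ range m, ((X + Y) * (X + Y + 1) * (X + 2 * i + 2))) *
        (∏ j ∈ range m, (Y + 2 * j + 2)) * hyperProd (X + 1) (Y + 1) m) =
      hyperProd X Y (m + 1) *
        ((∏ i ∈ range (m + 1), ((X + Y) * (X + Y + 1) * (X + 2 * i + 2))) *
          (∏ j ∈ range (m + 1), (Y + 2 * j + 2)) * hyperProd (X + 1) (Y + 1) (m + 1)) -
      ((∏ j ∈ range (m + 1), ((X + Y) * (Y + 2 * j))) * hyperProd (X + 2) (Y - 1) (m + 1)) *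
        ((∏ i ∈ range (m + 1), ((X + Y) * (X + 2 * i))) * hyperProd (X - 1) (Y + 2) (m + 1)) := by
  have hs : X + Y + (m + 1) ≠ 0 := by positivity
  have hshift := hyperProd_shift h (m + 1)
  have hX : ∏ i ∈ range (m + 1), (X + 2 * (i : ℚ)) =
      (∏ i ∈ range m, (X + 2 * (i : ℚ) + 2)) * X := by
    rw [prod_range_succ']
    congr 1
    · exact prod_congr rfl fun i _ => by push_cast; ring
    · simp
  have hY : ∏ i ∈ range (m + 1), (Y + 2 * (i : ℚ)) =
      (∏ i ∈ range m, (Y + 2 * (i : ℚ) + 2)) * Y := by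
    rw [prod_range_succ']
    congr 1
    · exact prod_congr rfl fun i _ => by push_cast; ring
    · simp
  have r1 : risingFac (X + Y) (m + 1) * (X + Y + (m + 1)) =
      (X + Y) * ((X + Y + 1) * risingFac (X + Y + 1 + 1) m) := by
    rw [← risingFac_succ', ← risingFac_succ', risingFac_succ _ (m + 1)]
    push_cast
    ring
  apply mul_left_cancel₀ hs
  simp only [prod_mul_distrib, prod_const, card_range, hX, hY]
  rw [prod_range_succ _ m, prod_range_succ _ m]
  rw [hyperProd_succ X Y (m + 1), risingFac_succ' (2 * X + Y + _), risingFac_succ' (X + 2 * Y + _),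
    Nat.factorial_succ]
  have e3 := hyperProd_succ (X + 1) (Y + 1) m
  rw [show X + 1 + (Y + 1) = X + Y + 1 + 1 by ring,
      show 2 * (X + 1) + (Y + 1) + 2 * (m : ℚ) = 2 * X + Y + 2 * (m + 1) + 1 by ring,
      show X + 1 + 2 * (Y + 1) + 2 * (m : ℚ) = X + 2 * Y + 2 * (m + 1) + 1 by ring] at e3
  push_cast at hshift ⊢
  rw [e3] at hshift ⊢
  set p := hyperProd X Y (m + 1)
  set q := hyperProd (X + 1) (Y + 1) m
  set u := hyperProd (X + 2) (Y - 1) (m + 1)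
  set w := hyperProd (X - 1) (Y + 2) (m + 1)
  set A := risingFac (2 * X + Y + 2 * (m + 1) + 1) m
  set B := risingFac (X + 2 * Y + 2 * (m + 1) + 1) m
  set C := risingFac (X + Y + 1 + 1) m
  set G := ∏ i ∈ range m, (X + 2 * (i : ℚ) + 2)
  set H := ∏ i ∈ range m, (Y + 2 * (i : ℚ) + 2)
  rw [pow_succ] at hshift ⊢
  rw [pow_succ] at hshift ⊢
  linear_combination (p * ((m + 1) * m.factorial * (2 * X + Y + 2 * (m + 1)) * A *
      ((X + 2 * Y + 2 * (m + 1)) * B)) * ((X + Y) ^ m * (X + Y + 1) ^ m * G * H * q)) * r1 +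
    ((X + Y) ^ m * (X + Y) * G * X * H * Y) * hshift

theorem det_hyperEntry_of_not_int {X Y : ℚ} (hX : ∀ z : ℤ, X ≠ z) (hY : ∀ z : ℤ, Y ≠ z)
    (h₁ : 0 < 2 * X + Y) (h₂ : 0 < X + 2 * Y) (n : ℕ) :
    (Matrix.of fun i j : Fin n => hyperEntry X Y i j).det = hyperProd X Y n := by
  induction n using Nat.strong_induction_on generalizing X Y with
  | _ n ih =>
    match n with
    | 0 => simp [hyperProd]
    | 1 => simp [hyperProd, hyperEntry, risingFac, fallingFac]
    | m + 2 =>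
      have shift : ∀ {Z : ℚ} (c : ℤ), (∀ z : ℤ, Z ≠ z) → ∀ z : ℤ, Z + c ≠ z := fun c hZ z e =>
        hZ (z - c) (by push_cast; linarith)
      have hX1 := shift 1 hX
      have hX2 := shift 2 hX
      have hX3 := shift (-1) hX
      have hY1 := shift 1 hY
      have hY2 := shift 2 hY
      have hY3 := shift (-1) hY
      push_cast [← sub_eq_add_neg] at hX1 hX2 hX3 hY1 hY2 hY3
      have hcond := det_condensation (hyperEntry X Y) m
      rw [det_hyperEntry_succ_succ, det_hyperEntry_succ_succ, det_hyperEntry_succ_left,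
        det_hyperEntry_succ_right, ih m (by lia) hX1 hY1 (by linarith) (by linarith),
        ih (m + 1) (by lia) hX hY (by linarith) (by linarith),
        ih (m + 1) (by lia) hX1 hY1 (by linarith) (by linarith),
        ih (m + 1) (by lia) hX2 hY3 (by linarith) (by linarith),
        ih (m + 1) (by lia) hX3 hY2 (by linarith) (by linarith),
        ← hyperProd_condensation (by linarith)] at hcond
      refine mul_right_cancel₀ (mul_ne_zero (mul_ne_zero ?_ ?_) ?_) hcond
      · refine prod_ne_zero_iff.2 fun i _ => mul_ne_zero (by nlinarith) fun e => ?_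
        exact hX (-(2 * i + 2)) (by push_cast; linarith)
      · refine prod_ne_zero_iff.2 fun i _ => fun e => ?_
        exact hY (-(2 * i + 2)) (by push_cast; linarith)
      · exact (hyperProd_pos (by linarith) (by linarith) m).ne'

theorem continuous_risingFac (k : ℕ) : Continuous fun z => risingFac z k := by
  unfold risingFac
  fun_prop

theorem continuous_fallingFac (k : ℕ) : Continuous fun z => fallingFac z k := by
  unfold fallingFac
  fun_prop

theorem det_hyperEntry (a b : ℤ) (h₁ : 0 < 2 * a + b) (h₂ : 0 < a + 2 * b) (n : ℕ) :
    (Matrix.of fun i j : Fin n => hyperEntry a b i j).det = hyperProd a b n := by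
  have hr := continuous_risingFac
  have hf := continuous_fallingFac
  have c1 : Continuous fun e : ℚ =>
      (Matrix.of fun i j : Fin n => hyperEntry (a + e) (b + e) i j).det := by
    refine Continuous.matrix_det (continuous_matrix fun i j => ?_)
    simp only [Matrix.of_apply, hyperEntry]
    exact (((hr _).comp (by fun_prop)).mul ((hf _).comp (by fun_prop))).mul
      ((hf _).comp (by fun_prop))
  have c2 : Continuous fun e : ℚ => hyperProd (a + e) (b + e) n := by
    simp only [hyperProd]
    refine continuous_finsetProd _ fun i _ => ?_
    exact ((continuous_const.mul ((hr _).comp (by fun_prop))).mul ((hr _).comp (by fun_prop))).mul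
      ((hr _).comp (by fun_prop))
  have hlim : Filter.Tendsto (fun k : ℕ => 1 / ((k : ℚ) + 1 + 1)) Filter.atTop (nhds 0) := by
    have := (Filter.tendsto_add_atTop_iff_nat 1).2
      (tendsto_one_div_add_atTop_nhds_zero_nat (𝕜 := ℚ))
    simpa using this
  have t1 := (c1.tendsto 0).comp hlim
  have t2 := (c2.tendsto 0).comp hlim
  simp only [add_zero] at t1 t2
  refine tendsto_nhds_unique t1 (t2.congr fun k => ?_)
  have hpos : (0 : ℚ) < 1 / ((k : ℚ) + 1 + 1) := by positivity
  have hlt : 1 / ((k : ℚ) + 1 + 1) < 1 := by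
    rw [div_lt_one (by positivity)]
    have : (0 : ℚ) ≤ k := by positivity
    linarith
  have hni : ∀ c z : ℤ, (c : ℚ) + 1 / ((k : ℚ) + 1 + 1) ≠ z := by
    intro c z e
    have e' : 1 / ((k : ℚ) + 1 + 1) = ((z - c : ℤ) : ℚ) := by push_cast; linarith
    rw [e'] at hpos hlt
    norm_cast at hpos hlt
    lia
  have g₁ : (0 : ℚ) < 2 * a + b := by exact_mod_cast h₁
  have g₂ : (0 : ℚ) < a + 2 * b := by exact_mod_cast h₂
  exact (det_hyperEntry_of_not_int (hni a) (hni b) (by linarith) (by linarith) n).symm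

/-- The sign of the permutation sorting the sequence `k`, and `0` if `k` is not injective. -/
def ordSign {n : ℕ} (k : Fin n → ℤ) : ℤ := ∏ i, ∏ j ∈ Ioi i, (k j - k i).sign

theorem sign_prod {ι : Type*} (s : Finset ι) (f : ι → ℤ) :
    (∏ i ∈ s, f i).sign = ∏ i ∈ s, (f i).sign :=
  map_prod (⟨⟨Int.sign, Int.sign_one⟩, Int.sign_mul⟩ : ℤ →* ℤ) f s

theorem ordSign_eq_sign_det {n : ℕ} (k : Fin n → ℤ) :
    ordSign k = (Matrix.vandermonde k).det.sign := by
  simp only [Matrix.det_vandermonde, sign_prod, ordSign]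

theorem ordSign_comp_perm {n : ℕ} (k : Fin n → ℤ) (π : Equiv.Perm (Fin n)) :
    ordSign (k ∘ π) = Equiv.Perm.sign π * ordSign k := by
  have : Matrix.vandermonde (k ∘ π) = (Matrix.vandermonde k).submatrix π id := rfl
  rw [ordSign_eq_sign_det, ordSign_eq_sign_det, this, Matrix.det_permute, Int.sign_mul]
  congr 1
  rcases Int.units_eq_one_or (Equiv.Perm.sign π) with h | h <;> simp [h]

theorem ordSign_of_strictMono {n : ℕ} {k : Fin n → ℤ} (hk : StrictMono k) : ordSign k = 1 :=
  prod_eq_one fun _ _ => prod_eq_one fun _ hj =>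
    Int.sign_eq_one_of_pos (sub_pos.2 (hk (mem_Ioi.1 hj)))

theorem ordSign_of_not_injective {n : ℕ} {k : Fin n → ℤ} (hk : ¬ Function.Injective k) :
    ordSign k = 0 := by
  rw [ordSign_eq_sign_det, Int.sign_eq_zero_iff_zero, Matrix.det_vandermonde_eq_zero_iff]
  simpa [Function.Injective, ← not_and] using hk

theorem ordSign_cons {n : ℕ} (l : ℤ) (k : Fin n → ℤ) :
    ordSign (Fin.cons l k : Fin (n + 1) → ℤ) = (∏ j, (k j - l).sign) * ordSign k := by
  simp [ordSign, Fin.prod_univ_succ, Fin.prod_Ioi_succ]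

theorem cons_removeNth {α : Type*} {n : ℕ} (j : Fin (n + 1)) (k : Fin (n + 1) → α) :
    (Fin.cons (k j) (j.removeNth k) : Fin (n + 1) → α) = k ∘ j.cycleRange.symm := by
  ext i
  refine Fin.cases ?_ (fun i => ?_) i
  · simp
  · simp [Fin.removeNth]

theorem ordSign_removeNth {n : ℕ} (j : Fin (n + 1)) (k : Fin (n + 1) → ℤ) :
    (-1) ^ (j : ℕ) * ordSign k =
      (∏ i, (k (j.succAbove i) - k j).sign) * ordSign (j.removeNth k) := by
  have := ordSign_cons (k j) (j.removeNth k)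
  rw [cons_removeNth, ordSign_comp_perm] at this
  simpa [Fin.removeNth] using this

theorem neg_one_pow_mul_ordSign_removeNth_add {n : ℕ} {k : Fin (n + 1) → ℤ} {a b : Fin (n + 1)}
    (h : k a = k b) (hab : a ≠ b) :
    (-1) ^ (a : ℕ) * ordSign (a.removeNth k) + (-1) ^ (b : ℕ) * ordSign (b.removeNth k) = 0 := by
  have key := (Matrix.detRowAlternating (n := Fin n)
    (R := ℤ)).neg_one_pow_smul_map_removeNth_add_eq_zero_of_eq
      (v := fun i p => k i ^ (p : ℕ)) (i := a) (j := b) (by simp [h]) hab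
  have e : ∀ c : Fin (n + 1), Matrix.detRowAlternating
      (c.removeNth fun (i : Fin (n + 1)) (p : Fin n) => k i ^ (p : ℕ)) =
      (Matrix.vandermonde (c.removeNth k)).det := fun c => rfl
  rw [e, e] at key
  have hs : ∀ m : ℕ, ((-1 : ℤ) ^ m).sign = (-1) ^ m := fun m => by
    rcases neg_one_pow_eq_or ℤ m with h | h <;> simp [h]
  have := congrArg Int.sign (eq_neg_of_add_eq_zero_left key)
  rw [smul_eq_mul, smul_eq_mul, Int.sign_neg, Int.sign_mul, Int.sign_mul, hs, hs,
    ← ordSign_eq_sign_det, ← ordSign_eq_sign_det] at this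
  rw [this]
  ring

theorem prod_sign_sub_eq (s : Finset ℤ) : ∀ l : ℤ,
    ∏ k ∈ s, (k - l).sign = (if Odd s.card then 0 else 1) +
      ∑ k ∈ s, (k - l).sign * ∏ k' ∈ s.erase k, (k' - k).sign := by
  induction s using Finset.induction_on_min with
  | empty => simp
  | insert a s ha ih =>
    intro l
    have has : a ∉ s := fun h => lt_irrefl a (ha a h)
    have hone : ∀ b ≤ a, ∏ k ∈ s, (k - b).sign = 1 := fun b hb => prod_eq_one fun k hk =>
      Int.sign_eq_one_of_pos (by have := ha k hk; lia)
    have herase : ∀ k ∈ s, ∏ k' ∈ (insert a s).erase k, (k' - k).sign =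
        -∏ k' ∈ s.erase k, (k' - k).sign := by
      intro k hk
      have hak : a ≠ k := fun h => has (h ▸ hk)
      rw [erase_insert_of_ne hak, prod_insert (fun h => has (mem_of_mem_erase h)),
        Int.sign_eq_neg_one_of_neg (by have := ha k hk; lia), neg_one_mul]
    have hsum : ∀ b ≤ a, ∑ k ∈ s, (k - b).sign * ∏ k' ∈ s.erase k, (k' - k).sign =
        ∑ k ∈ s, ∏ k' ∈ s.erase k, (k' - k).sign := fun b hb => sum_congr rfl fun k hk => by
      rw [Int.sign_eq_one_of_pos (by have := ha k hk; lia), one_mul]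
    have hc := ih a
    rw [hone a le_rfl, hsum a le_rfl] at hc
    rw [prod_insert has, sum_insert has, erase_insert has, hone a le_rfl, mul_one,
      card_insert_of_notMem has,
      sum_congr rfl fun k hk => by rw [herase k hk, mul_neg], sum_neg_distrib]
    have hcard : (if Odd (s.card + 1) then (0 : ℤ) else 1) =
        1 - (if Odd s.card then 0 else 1) := by
      by_cases h : Odd s.card <;> simp [h, Nat.odd_add_one]
    rw [hcard]
    rcases le_or_gt l a with hl | hl
    · rw [hone l hl, hsum l hl]
      linarith
    · rw [Int.sign_eq_neg_one_of_neg (by lia), ih l]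
      ring

theorem ordSign_cons_expand {m : ℕ} (l : ℤ) (k : Fin (m + 1) → ℤ) :
    ordSign (Fin.cons l k : Fin (m + 2) → ℤ) = (if Odd (m + 1) then 0 else 1) * ordSign k +
      ∑ j : Fin (m + 1), (-1) ^ (j : ℕ) * ordSign (j.removeNth k) * (k j - l).sign := by
  by_cases hk : Function.Injective k
  · have himg := prod_sign_sub_eq (univ.image k) l
    rw [prod_image hk.injOn, sum_image hk.injOn, card_image_of_injective _ hk, card_univ,
      Fintype.card_fin] at himg
    rw [ordSign_cons, himg, add_mul, sum_mul]
    congr 1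
    refine sum_congr rfl fun j _ => ?_
    have h1 : ∏ k' ∈ (univ.image k).erase (k j), (k' - k j).sign =
        ∏ i, (k (j.succAbove i) - k j).sign := by
      have : (univ.image k).erase (k j) = univ.image (k ∘ j.succAbove) := by
        ext z
        simp only [mem_erase, mem_image, mem_univ, true_and, Function.comp]
        constructor
        · rintro ⟨hz, i, rfl⟩
          obtain ⟨i', rfl⟩ := Fin.exists_succAbove_eq (x := i) (y := j) (fun h => hz (h ▸ rfl))
          exact ⟨i', rfl⟩
        · rintro ⟨i, rfl⟩
          exact ⟨fun h => Fin.succAbove_ne j i (hk h), _, rfl⟩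
      rw [this, prod_image (hk.comp (Fin.succAbove_right_injective)).injOn]
      rfl
    have h2 := ordSign_removeNth j k
    have h3 : (∏ i, (k (j.succAbove i) - k j).sign) * (∏ i, (k (j.succAbove i) - k j).sign) = 1 := by
      rw [← prod_mul_distrib]
      refine prod_eq_one fun i _ => ?_
      have : k (j.succAbove i) - k j ≠ 0 := fun h =>
        Fin.succAbove_ne j i (hk (sub_eq_zero.1 h))
      rcases lt_or_gt_of_ne this with h | h
      · simp [Int.sign_eq_neg_one_of_neg h]
      · simp [Int.sign_eq_one_of_pos h]
    have h4 : ((-1 : ℤ) ^ (j : ℕ)) * (-1) ^ (j : ℕ) = 1 := by rw [← mul_pow]; simp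
    rw [h1]
    set c := ∏ i, (k (j.succAbove i) - k j).sign
    linear_combination (c * (-1) ^ (j : ℕ) * (k j - l).sign) * h2 +
      ((-1) ^ (j : ℕ) * ordSign (j.removeNth k) * (k j - l).sign) * h3 -
      (c * (k j - l).sign * ordSign k) * h4
  · have h0 : ¬ Function.Injective (Fin.cons l k : Fin (m + 2) → ℤ) := fun h =>
      hk (Fin.cons_injective_iff.1 h).2
    rw [ordSign_of_not_injective h0, ordSign_of_not_injective hk, mul_zero, zero_add]
    obtain ⟨a, b, hab, hne⟩ : ∃ a b, k a = k b ∧ a ≠ b := by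
      simpa [Function.Injective, ← not_and] using hk
    rw [← sum_subset (subset_univ {a, b}), sum_pair hne, hab, ← add_mul,
      neg_one_pow_mul_ordSign_removeNth_add hab hne, zero_mul]
    intro j _ hj
    simp only [mem_insert, mem_singleton, not_or] at hj
    obtain ⟨a', rfl⟩ := Fin.exists_succAbove_eq (x := a) (y := j) (Ne.symm hj.1)
    obtain ⟨b', rfl⟩ := Fin.exists_succAbove_eq (x := b) (y := j) (Ne.symm hj.2)
    rw [ordSign_of_not_injective (k := j.removeNth k), mul_zero, zero_mul]
    exact fun h => hne (congrArg _ (h hab))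

/-- The sum of `∏ f i (k i)` over all sequences `k` with values below `N`, signed by `ordSign k`;
equivalently, the sum of all maximal minors of the matrix `f i j`, `j < N`. -/
def signSum (N : ℕ) {n : ℕ} (f : Fin n → ℕ → ℤ) : ℤ :=
  ∑ k : Fin n → Fin N, (∏ i, f i (k i)) * ordSign fun i => ((k i : ℕ) : ℤ)

/-- The sum of the entries below `N`. -/
def totalSum (N : ℕ) (g : ℕ → ℤ) : ℤ := ∑ l : Fin N, g l

/-- The skew-symmetric form given by the sum of all `2 × 2` minors. -/
def skewPair (N : ℕ) (g h : ℕ → ℤ) : ℤ :=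
  ∑ l : Fin N, ∑ k : Fin N, g l * h k * (((k : ℕ) : ℤ) - ((l : ℕ) : ℤ)).sign

theorem skewPair_comm (N : ℕ) (g h : ℕ → ℤ) : skewPair N g h = -skewPair N h g := by
  unfold skewPair
  rw [sum_comm, ← sum_neg_distrib]
  refine sum_congr rfl fun l _ => ?_
  rw [← sum_neg_distrib]
  refine sum_congr rfl fun k _ => ?_
  have : (((l : ℕ) : ℤ) - ((k : ℕ) : ℤ)).sign = -(((k : ℕ) : ℤ) - ((l : ℕ) : ℤ)).sign := by
    rw [← Int.sign_neg, neg_sub]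
  rw [this]
  ring

theorem signSum_comp_perm (N : ℕ) {n : ℕ} (f : Fin n → ℕ → ℤ) (π : Equiv.Perm (Fin n)) :
    signSum N (f ∘ π) = Equiv.Perm.sign π * signSum N f := by
  unfold signSum
  rw [mul_sum]
  refine Fintype.sum_equiv (Equiv.arrowCongr π (Equiv.refl _)) _ _ fun k => ?_
  have h := ordSign_comp_perm (fun i => ((Equiv.arrowCongr π (Equiv.refl (Fin N)) k i : ℕ) : ℤ)) π
  have e : (fun i => ((Equiv.arrowCongr π (Equiv.refl (Fin N)) k i : ℕ) : ℤ)) ∘ π =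
      fun i => ((k i : ℕ) : ℤ) := by
    ext i
    simp
  rw [e] at h
  rw [h, ← Equiv.prod_comp π (fun i => f i (Equiv.arrowCongr π (Equiv.refl (Fin N)) k i))]
  simp
  ring

theorem signSum_eq_zero (N : ℕ) {n : ℕ} {f : Fin n → ℕ → ℤ} {a b : Fin n} (h : f a = f b)
    (hab : a ≠ b) : signSum N f = 0 := by
  have := signSum_comp_perm N f (Equiv.swap a b)
  have e : f ∘ Equiv.swap a b = f := by
    ext i
    by_cases ha : i = a
    · simp [ha, h]
    · by_cases hb : i = b
      · simp [hb, h]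
      · simp [Equiv.swap_apply_of_ne_of_ne ha hb]
  rw [e, Equiv.Perm.sign_swap hab] at this
  simp at this
  lia

theorem signSum_cons (N : ℕ) {m : ℕ} (g : ℕ → ℤ) (f : Fin (m + 1) → ℕ → ℤ) :
    signSum N (Fin.cons g f : Fin (m + 2) → ℕ → ℤ) =
      (if Odd (m + 1) then 0 else 1) * signSum N f * totalSum N g +
      ∑ j : Fin (m + 1), (-1) ^ (j : ℕ) * signSum N (j.removeNth f) * skewPair N g (f j) := by
  have h1 : signSum N (Fin.cons g f : Fin (m + 2) → ℕ → ℤ) =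
      ∑ l : Fin N, ∑ k : Fin (m + 1) → Fin N, (g l * ∏ i, f i (k i)) *
        ordSign (Fin.cons (l : ℤ) fun i => ((k i : ℕ) : ℤ) : Fin (m + 2) → ℤ) := by
    unfold signSum
    rw [← Equiv.sum_comp (Fin.consEquiv fun _ => Fin N), Fintype.sum_prod_type]
    refine sum_congr rfl fun l _ => sum_congr rfl fun k _ => ?_
    congr 1
    · simp [Fin.prod_univ_succ]
    · congr 1
      ext i
      refine Fin.cases ?_ (fun i => ?_) i <;> simp
  have h2 : ∀ j : Fin (m + 1), signSum N (j.removeNth f) * skewPair N g (f j) =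
      ∑ l : Fin N, ∑ k : Fin (m + 1) → Fin N, (g l * ∏ i, f i (k i)) *
        (ordSign (j.removeNth fun i => ((k i : ℕ) : ℤ)) * ((k j : ℤ) - (l : ℤ)).sign) := by
    intro j
    unfold signSum skewPair
    rw [mul_sum]
    refine sum_congr rfl fun l _ => ?_
    rw [← Equiv.sum_comp (Fin.insertNthEquiv (fun _ => Fin N) j), Fintype.sum_prod_type, mul_sum]
    refine sum_congr rfl fun c _ => ?_
    rw [sum_mul]
    refine sum_congr rfl fun k _ => ?_
    rw [Fin.prod_univ_succAbove _ j]
    have : (j.removeNth fun i => (((Fin.insertNthEquiv (fun _ => Fin N) j (c, k)) i : ℕ) : ℤ)) =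
        fun i => ((k i : ℕ) : ℤ) := by
      ext i
      simp [Fin.removeNth]
    rw [this]
    simp [Fin.removeNth]
    ring
  rw [h1]
  simp only [ordSign_cons_expand, mul_add, sum_add_distrib, mul_sum]
  congr 1
  · unfold signSum totalSum
    rw [mul_sum]
    refine sum_congr rfl fun l _ => ?_
    rw [mul_sum, sum_mul]
    refine sum_congr rfl fun k _ => ?_
    ring
  · simp only [mul_assoc, h2, mul_sum]
    refine (sum_congr rfl fun l _ => sum_comm).trans (sum_comm.trans ?_)
    refine sum_congr rfl fun j _ => sum_congr rfl fun l _ => sum_congr rfl fun k _ => ?_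
    ring

/-- The totals of the rows `g i`, followed by their pairings with `g 0, g 1, …`. -/
def borderEntry (N : ℕ) (g : ℕ → ℕ → ℤ) (i : ℕ) : ℕ → ℤ
  | 0 => totalSum N (g i)
  | j + 1 => skewPair N (g j) (g i)

theorem signSum_mul_det_borderEntry (N : ℕ) (g : ℕ → ℕ → ℤ) (m : ℕ) :
    signSum N (fun i : Fin m => g i) *
        (Matrix.of fun i j : Fin (m + 2) => borderEntry N g i j).det =
      signSum N (fun i : Fin (m + 2) => g i) *
        (Matrix.of fun i j : Fin (m + 1) => borderEntry N g i j).det := by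
  set f : Fin (m + 1) → ℕ → ℤ := fun i => g i with hf
  set C : Matrix (Fin (m + 2)) (Fin (m + 2)) ℤ := Matrix.of fun i j => borderEntry N g i j with hC
  set v : Fin (m + 2) → ℤ := Fin.cons ((if Odd (m + 1) then 0 else 1) * signSum N f)
    fun j => -((-1) ^ (j : ℕ) * signSum N (j.removeNth f)) with hv
  have hsum : ∀ i : Fin (m + 2), ∑ j, v j • C i j =
      signSum N (Fin.cons (g i) f : Fin (m + 2) → ℕ → ℤ) := by
    intro i
    rw [signSum_cons, Fin.sum_univ_succ]
    congr 1
    refine sum_congr rfl fun j _ => ?_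
    rw [skewPair_comm N (g i)]
    simp [hv, hC, hf, borderEntry]
  have hmid : ∀ i : Fin (m + 1),
      signSum N (Fin.cons (g i.castSucc) f : Fin (m + 2) → ℕ → ℤ) = 0 := fun i =>
    signSum_eq_zero N (a := 0) (b := i.succ) (by simp [hf]) (Fin.succ_ne_zero i).symm
  have hlast : signSum N (Fin.cons (g (Fin.last (m + 1))) f : Fin (m + 2) → ℕ → ℤ) =
      (-1) ^ (m + 1) * signSum N (fun i : Fin (m + 2) => g i) := by
    have e : (Fin.cons (g (Fin.last (m + 1))) f : Fin (m + 2) → ℕ → ℤ) =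
        (fun i : Fin (m + 2) => g i) ∘ (Fin.last (m + 1)).cycleRange.symm := by
      rw [← cons_removeNth]
      congr 1
      ext i
      simp [Fin.removeNth, hf]
    rw [e, signSum_comp_perm]
    simp
  have hvl : v (Fin.last (m + 1)) = (-1) ^ (m + 1) * signSum N (fun i : Fin m => g i) := by
    have e : (Fin.last m).removeNth f = fun i : Fin m => g i := by
      ext i
      simp [Fin.removeNth, hf]
    rw [← Fin.succ_last, hv, Fin.cons_succ, e, Fin.val_last]
    ring
  have key := Matrix.det_updateCol_sum C (Fin.last (m + 1)) v
  rw [Matrix.det_succ_column _ (Fin.last (m + 1)), Fin.sum_univ_castSucc, sum_eq_zero] at key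
  · simp only [Matrix.updateCol_self, hsum, hlast, hvl] at key
    have e1 : (C.updateCol (Fin.last (m + 1)) fun i =>
        signSum N (Fin.cons (g i) f : Fin (m + 2) → ℕ → ℤ)).submatrix
          (Fin.last (m + 1)).succAbove (Fin.last (m + 1)).succAbove =
        Matrix.of fun i j : Fin (m + 1) => borderEntry N g i j := by
      ext i j
      simp [hC]
    rw [e1] at key
    have h1 : ((-1 : ℤ) ^ (m + 1)) * (-1) ^ (m + 1) = 1 := by rw [← mul_pow]; simp
    simp only [Fin.val_last, zero_add, smul_eq_mul, pow_add _ (m + 1) (m + 1)] at key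
    linear_combination (-(-1) ^ (m + 1)) * key + (-signSum N (fun i : Fin m => g i) * C.det +
      signSum N (fun i : Fin (m + 2) => g i) *
        (Matrix.of fun i j : Fin (m + 1) => borderEntry N g i j).det *
        (1 + (-1 : ℤ) ^ (m + 1) * (-1) ^ (m + 1))) * h1
  · intro i _
    simp only [Matrix.updateCol_self, hsum, hmid]
    ring

open Polynomial in
/-- The generating polynomial of the row `C(x+i, j-i)`. -/
noncomputable def rowPoly (x i : ℕ) : ℤ[X] := X ^ i * (1 + X) ^ (x + i)

open Polynomial in
theorem coeff_X_pow_mul_one_add_X_pow (A a l : ℕ) (hl : l ≤ A + a) :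
    (X ^ a * (1 + X) ^ A : ℤ[X]).coeff l = ((1 + X) ^ A : ℤ[X]).coeff (A + a - l) := by
  rw [coeff_X_pow_mul', coeff_one_add_X_pow]
  split_ifs with h
  · rw [coeff_one_add_X_pow, show A + a - l = A - (l - a) by lia, Nat.choose_symm (by lia)]
  · rw [coeff_one_add_X_pow, Nat.choose_eq_zero_of_lt (by lia), Nat.cast_zero]

open Polynomial in
theorem coeff_rowPoly_eq_zero {x i l : ℕ} (h : x + 2 * i < l) : (rowPoly x i).coeff l = 0 := by
  rw [rowPoly, coeff_X_pow_mul', if_pos (by lia), coeff_one_add_X_pow,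
    Nat.choose_eq_zero_of_lt (by lia), Nat.cast_zero]

open Polynomial in
theorem sum_coeff_mul_coeff (N A a : ℕ) (hN : A + a < N) (q : ℤ[X]) :
    ∑ l ∈ range N, (X ^ a * (1 + X) ^ A : ℤ[X]).coeff l * q.coeff l =
      ((1 + X) ^ A * q).coeff (A + a) := by
  rw [mul_comm _ q, coeff_mul, Nat.sum_antidiagonal_eq_sum_range_succ
    (fun k l => q.coeff k * ((1 + X) ^ A : ℤ[X]).coeff l)]
  refine (sum_subset_zero_on_sdiff (range_subset_range.2 hN) (fun l hl => ?_)
    fun l hl => ?_).symm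
  · simp only [mem_sdiff, mem_range] at hl
    rw [coeff_X_pow_mul', if_pos (by lia), coeff_one_add_X_pow,
      Nat.choose_eq_zero_of_lt (by lia), Nat.cast_zero, zero_mul]
  · rw [coeff_X_pow_mul_one_add_X_pow A a l (by simpa [Nat.lt_succ_iff] using hl), mul_comm]

open Polynomial in
theorem sum_coeff_one_sub_X_mul (h : ℤ[X]) (l M : ℕ) :
    ∑ k ∈ range (M + 1), ((1 - X) * h).coeff k * ((k : ℤ) - (l : ℤ)).sign =
      h.coeff M * ((M : ℤ) - (l : ℤ)).sign - (if l ≤ M then (X * h).coeff l else 0) -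
        if l < M then h.coeff l else 0 := by
  induction M with
  | zero =>
    rcases Nat.eq_zero_or_pos l with rfl | hl
    · simp
    · simp [sub_mul, hl.ne', one_mul]
  | succ M ih =>
    rw [sum_range_succ, ih, sub_mul, one_mul, coeff_sub, coeff_X_mul]
    rcases lt_trichotomy l (M + 1) with hl | rfl | hl
    · rcases Nat.lt_succ_iff_lt_or_eq.1 hl with hl' | rfl
      · rw [Int.sign_eq_one_of_pos (by lia), Int.sign_eq_one_of_pos (by lia), if_pos hl'.le,
          if_pos hl', if_pos (by lia), if_pos hl]
        ring
      · rw [sub_self, Int.sign_zero, Int.sign_eq_one_of_pos (by lia), if_pos le_rfl,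
          if_neg (lt_irrefl _), if_pos (by lia), if_pos hl]
        ring
    · rw [sub_self, Int.sign_zero, Int.sign_eq_neg_one_of_neg (by lia), if_neg (by lia),
        if_neg (by lia), if_pos le_rfl, if_neg (lt_irrefl _), coeff_X_mul]
      ring
    · rw [Int.sign_eq_neg_one_of_neg (by lia), Int.sign_eq_neg_one_of_neg (by lia),
        if_neg (by lia), if_neg (by lia), if_neg (by lia), if_neg (by lia)]
      ring

open Polynomial in
theorem skewPair_one_sub_X_mul {N : ℕ} (p h : ℤ[X]) (hh : ∀ k, N ≤ k + 1 → h.coeff k = 0) :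
    skewPair N p.coeff ((1 - X) * h).coeff =
      -∑ l ∈ range N, p.coeff l * ((1 + X) * h).coeff l := by
  rcases N with - | M
  · simp [skewPair]
  unfold skewPair
  have hr := Fin.sum_univ_eq_sum_range (fun l => p.coeff l * ((1 + X) * h).coeff l) (M + 1)
  rw [← hr, ← sum_neg_distrib]
  refine sum_congr rfl fun l _ => ?_
  have hs := sum_coeff_one_sub_X_mul h l M
  have hk := Fin.sum_univ_eq_sum_range
    (fun k => ((1 - X) * h).coeff k * ((k : ℤ) - ((l : ℕ) : ℤ)).sign) (M + 1)
  rw [hh M le_rfl, ← hk] at hs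
  simp only [mul_assoc]
  rw [← mul_sum, hs, if_pos (by lia), add_mul, one_mul, coeff_add]
  split_ifs with hl
  · ring
  · rw [hh l (by lia)]
    ring

open Polynomial in
theorem totalSum_rowPoly {N x i : ℕ} (hN : x + 2 * i < N) :
    totalSum N (rowPoly x i).coeff = 2 ^ (x + i) := by
  have hdeg : (rowPoly x i).natDegree < N :=
    lt_of_le_of_lt (natDegree_le_iff_coeff_eq_zero.2 fun l hl => coeff_rowPoly_eq_zero hl) hN
  have := eval_eq_sum_range' hdeg 1
  rw [totalSum, Fin.sum_univ_eq_sum_range (fun l => (rowPoly x i).coeff l)]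
  simp only [one_pow, mul_one] at this
  rw [← this, rowPoly]
  norm_num

/-- The pairing of the `j`-th row with the difference of row `i+1` and twice row `i`. -/
noncomputable def reducedEntry (x i j : ℕ) : ℤ :=
  (if i < x + 2 * j then ((2 * x + 1 + i + j).choose (x + 2 * j - i - 1) : ℤ) else 0) +
    2 * if i ≤ x + 2 * j then ((2 * x + 1 + i + j).choose (x + 2 * j - i) : ℤ) else 0

open Polynomial in
theorem skewPair_rowPoly_succ {N x i j : ℕ} (hi : x + 2 * i + 2 < N) (hj : x + 2 * j < N) :
    skewPair N (rowPoly x j).coeff (rowPoly x (i + 1)).coeff =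
      2 * skewPair N (rowPoly x j).coeff (rowPoly x i).coeff + reducedEntry x i j := by
  have hlin : skewPair N (rowPoly x j).coeff (rowPoly x (i + 1) - 2 * rowPoly x i).coeff =
      skewPair N (rowPoly x j).coeff (rowPoly x (i + 1)).coeff -
        2 * skewPair N (rowPoly x j).coeff (rowPoly x i).coeff := by
    unfold skewPair
    simp only [mul_sum, ← sum_sub_distrib]
    refine sum_congr rfl fun l _ => sum_congr rfl fun k _ => ?_
    rw [coeff_sub, ← C_ofNat, coeff_C_mul]
    ring
  have hfac : rowPoly x (i + 1) - 2 * rowPoly x i =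
      (1 - X) * -(rowPoly x i * X + 2 * rowPoly x i) := by
    simp only [rowPoly]
    ring
  have hval := skewPair_one_sub_X_mul (N := N) (rowPoly x j)
    (-(rowPoly x i * X + 2 * rowPoly x i)) (by
      intro k hk
      obtain ⟨k, rfl⟩ : ∃ k', k = k' + 1 := ⟨k - 1, by lia⟩
      rw [coeff_neg, coeff_add, coeff_mul_X, ← C_ofNat, coeff_C_mul,
        coeff_rowPoly_eq_zero (by lia), coeff_rowPoly_eq_zero (by lia)]
      ring)
  rw [← hfac, hlin] at hval
  have hsum := sum_coeff_mul_coeff N (x + j) j (by lia)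
    ((1 + X) * -(rowPoly x i * X + 2 * rowPoly x i))
  rw [← rowPoly] at hsum
  rw [hsum] at hval
  have hprod : (1 + X) ^ (x + j) * ((1 + X) * -(rowPoly x i * X + 2 * rowPoly x i)) =
      -(X ^ (i + 1) * (1 + X) ^ (2 * x + 1 + i + j) +
        C 2 * (X ^ i * (1 + X) ^ (2 * x + 1 + i + j)) : ℤ[X]) := by
    simp only [rowPoly, C_ofNat]
    ring
  rw [hprod, coeff_neg, neg_neg, coeff_add, coeff_C_mul, coeff_X_pow_mul', coeff_X_pow_mul',
    coeff_one_add_X_pow, coeff_one_add_X_pow] at hval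
  rw [reducedEntry, ← sub_eq_iff_eq_add', hval, show x + j + j = x + 2 * j by ring]
  simp only [Nat.succ_le_iff, Nat.sub_sub]

theorem det_borderEntry_rowPoly {N x m : ℕ} (hN : x + 2 * m < N) :
    (Matrix.of fun i j : Fin (m + 1) => borderEntry N (fun i => (rowPoly x i).coeff) i j).det =
      2 ^ x * (Matrix.of fun i j : Fin m => reducedEntry x i j).det := by
  rw [Matrix.det_eq_of_forall_row_eq_smul_add_pred
    (B := Matrix.of fun i j : Fin (m + 1) => (Fin.cons
      (borderEntry N (fun i => (rowPoly x i).coeff) 0)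
      (fun i : Fin m => fun j => Nat.casesOn j 0 fun j => reducedEntry x i j) :
        Fin (m + 1) → ℕ → ℤ) i j) (fun _ => 2), Matrix.det_succ_column_zero, Fin.sum_univ_succ,
    sum_eq_zero]
  · have e : ∀ M : Matrix (Fin (m + 1)) (Fin (m + 1)) ℤ,
      M.submatrix (Fin.succAbove 0) Fin.succ = M.submatrix Fin.succ Fin.succ := fun M => by
        simp
    rw [e]
    simp only [Fin.val_zero, pow_zero, one_mul, add_zero, Matrix.of_apply, Fin.cons_zero,
      borderEntry, totalSum_rowPoly (show x + 2 * 0 < N by lia)]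
    congr 2
  · intro i _
    simp
  · intro j
    simp
  · intro i j
    refine Fin.cases ?_ (fun j => ?_) j
    · simp [borderEntry, totalSum_rowPoly (show x + 2 * (i : ℕ) < N by lia),
        totalSum_rowPoly (show x + 2 * (i + 1 : ℕ) < N by lia)]
      ring
    · simp [borderEntry, skewPair_rowPoly_succ (show x + 2 * (i : ℕ) + 2 < N by lia)
        (show x + 2 * (j : ℕ) < N by lia)]
      ring

theorem signSum_eq_of_le {M N : ℕ} (h : M ≤ N) {n : ℕ} {f : Fin n → ℕ → ℤ}
    (hf : ∀ i k, M ≤ k → f i k = 0) : signSum M f = signSum N f := by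
  refine Fintype.sum_of_injective (fun k i => Fin.castLE h (k i)) (fun k k' hk => ?_) _ _
    (fun k hk => ?_) fun k => rfl
  · ext i
    simpa using congrArg Fin.val (congrFun hk i)
  · obtain ⟨i, hi⟩ : ∃ i, M ≤ (k i : ℕ) := by
      by_contra! hlt
      exact hk ⟨fun i => ⟨k i, hlt i⟩, rfl⟩
    rw [prod_eq_zero (mem_univ i) (hf i _ hi), zero_mul]

theorem sum_strictMono_det (N : ℕ) {n : ℕ} (f : Fin n → ℕ → ℤ) :
    (∑ l : Fin n → Fin N, if StrictMono l then
      (Matrix.of fun i j : Fin n => f i (l j)).det else 0) = signSum N f := by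
  have h1 : ∀ l : Fin n → Fin N, (Matrix.of fun i j : Fin n => f i (l j)).det =
      ∑ π : Equiv.Perm (Fin n), (Equiv.Perm.sign π : ℤ) * ∏ i, f i (l (π i)) := fun l => by
    rw [← Matrix.det_transpose, Matrix.det_apply']
    rfl
  simp only [h1]
  rw [← sum_filter, ← sum_product']
  refine sum_of_injOn (fun p => p.1 ∘ p.2) ?_ (fun _ _ => mem_coe.2 (mem_univ _)) ?_ ?_
  · rintro ⟨l, π⟩ h ⟨l', π'⟩ h' e
    simp only [coe_product, coe_filter, coe_univ, mem_univ, true_and, Set.mem_prod,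
      Set.mem_ofPred_eq, Set.mem_univ, and_true] at h h' e
    have hl : l = l' := by
      rw [← h.range_inj h', ← EquivLike.range_comp l π, e, EquivLike.range_comp]
    subst hl
    rw [Prod.mk.injEq]
    exact ⟨rfl, Equiv.ext fun i => h.injective (congrFun e i)⟩
  · intro k _ hk
    rw [ordSign_of_not_injective, mul_zero]
    intro hinj
    have hinj' : Function.Injective k := fun a b hab => hinj (by simp [hab])
    refine hk ⟨(k ∘ Tuple.sort k, (Tuple.sort k)⁻¹), ?_, ?_⟩
    · simpa using (Tuple.monotone_sort k).strictMono_of_injective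
        (hinj'.comp (Tuple.sort k).injective)
    · ext i
      simp
  · rintro ⟨l, π⟩ h
    simp only [mem_product, mem_filter, mem_univ, true_and, and_true] at h
    have h2 := ordSign_comp_perm (fun i => ((l i : ℕ) : ℤ)) π
    rw [ordSign_of_strictMono (k := fun i => ((l i : ℕ) : ℤ)) (fun a b hab => by simpa using h hab),
      mul_one] at h2
    have h3 : (ordSign fun i => (((l ∘ π) i : ℕ) : ℤ)) = Equiv.Perm.sign π := h2
    rw [h3, mul_comm]
    rfl

theorem ibinom_eq_coeff_rowPoly (x i k : ℕ) :
    ibinom ((x : ℤ) + i) ((k : ℤ) - i) = (rowPoly x i).coeff k := by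
  rw [ibinom, rowPoly, Polynomial.coeff_X_pow_mul', Polynomial.coeff_one_add_X_pow]
  by_cases h : i ≤ k
  · rw [if_pos h, show ((k : ℤ) - i).toNat = k - i by lia, show ((x : ℤ) + i).toNat = x + i by lia]
    split_ifs with h'
    · rfl
    · rw [Nat.choose_eq_zero_of_lt (by lia), Nat.cast_zero]
  · rw [if_neg h, if_neg (by lia)]

theorem Sminor_eq_signSum {x n N : ℕ} (h : 2 * n + x - 1 ≤ N) :
    Sminor x n = signSum N fun i : Fin n => (rowPoly x i).coeff := by
  rw [← signSum_eq_of_le h fun i k hk => coeff_rowPoly_eq_zero (by lia), ← sum_strictMono_det]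
  simp only [Sminor, ibinom_eq_coeff_rowPoly]

theorem Sminor_zero (x : ℕ) : Sminor x 0 = 1 := by
  rw [Sminor_eq_signSum le_rfl]
  simp [signSum, ordSign]

theorem Sminor_one (x : ℕ) : Sminor x 1 = 2 ^ x := by
  rw [Sminor_eq_signSum le_rfl, ← add_zero x, ← totalSum_rowPoly (x := x) (i := 0)
    (N := 2 * 1 + x - 1) (by lia)]
  refine Fintype.sum_equiv (Equiv.funUnique (Fin 1) _) _ _ fun k => ?_
  simp [ordSign]

theorem Sminor_mul_det_reducedEntry (x m : ℕ) :
    Sminor x m * (Matrix.of fun i j : Fin (m + 1) => reducedEntry x i j).det =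
      Sminor x (m + 2) * (Matrix.of fun i j : Fin m => reducedEntry x i j).det := by
  have key := signSum_mul_det_borderEntry (2 * (m + 2) + x) (fun i => (rowPoly x i).coeff) m
  rw [det_borderEntry_rowPoly (by lia), det_borderEntry_rowPoly (by lia),
    ← Sminor_eq_signSum (by lia), ← Sminor_eq_signSum (by lia)] at key
  refine mul_left_cancel₀ (pow_ne_zero x (two_ne_zero (α := ℤ))) ?_
  linear_combination key

theorem risingFac_mul_factorial (n k : ℕ) :
    risingFac (n + 1) k * n.factorial = (n + k).factorial := by
  induction k with
  | zero => simp [risingFac]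
  | succ k ih =>
    rw [risingFac_succ, ← add_assoc, Nat.factorial_succ]
    push_cast
    linear_combination (n + 1 + k : ℚ) * ih

theorem fallingFac_natCast (n k : ℕ) : fallingFac n k = n.descFactorial k := by
  induction k with
  | zero => simp [fallingFac]
  | succ k ih =>
    rw [fallingFac, prod_range_succ, ← fallingFac, ih, Nat.descFactorial_succ, mul_comm]
    rcases le_or_gt k n with h | h
    · push_cast [h]
      ring
    · simp [Nat.descFactorial_eq_zero_iff_lt.2 h]

theorem choose_pred_mul_factorial_mul_factorial {a b M : ℕ} (h : a + b = M + 1) :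
    (if 0 < a then M.choose (a - 1) else 0) * (a.factorial * b.factorial) = a * M.factorial := by
  rcases a with - | a
  · simp
  · rw [if_pos (Nat.succ_pos a), Nat.add_sub_cancel, Nat.factorial_succ,
      ← Nat.choose_mul_factorial_mul_factorial (show a ≤ M by lia), show M - a = b by lia]
    ring

theorem choose_mul_factorial_mul_factorial_succ {a b M : ℕ} (h : a + b = M + 1) :
    M.choose a * (a.factorial * b.factorial) = b * M.factorial := by
  rcases b with - | b
  · simp [Nat.choose_eq_zero_of_lt (show M < a by lia)]
  · rw [Nat.factorial_succ, ← Nat.choose_mul_factorial_mul_factorial (show a ≤ M by lia),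
      show M - a = b by lia]
    ring

theorem reducedEntry_mul_factorial (x i j : ℕ) :
    (reducedEntry x i j : ℚ) * (((x + 2 * i + 2).factorial : ℚ) * (x + 2 * j).factorial) =
      (3 * x + 3 * i + 4) * (2 * x + 1).factorial *
        hyperEntry ((x + 2 : ℤ) : ℚ) ((x : ℤ) : ℚ) i j := by
  have hr := risingFac_mul_factorial (2 * x + 1) (i + j)
  have e1 : ((x + 2 : ℤ) : ℚ) + ((x : ℤ) : ℚ) = ((2 * x + 1 : ℕ) : ℚ) + 1 := by push_cast; ring
  have e2 : ((x + 2 : ℤ) : ℚ) + 2 * (i : ℚ) = ((x + 2 * i + 2 : ℕ) : ℚ) := by push_cast; ring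
  have e3 : ((x : ℤ) : ℚ) + 2 * (j : ℚ) = ((x + 2 * j : ℕ) : ℚ) := by push_cast; ring
  rw [hyperEntry, e1, e2, e3, fallingFac_natCast, fallingFac_natCast]
  rcases le_or_gt i (x + 2 * j) with hi | hi
  · rcases le_or_gt j (x + 2 * i + 2) with hj | hj
    · obtain ⟨a, ha⟩ := Nat.exists_eq_add_of_le hi
      obtain ⟨b, hb⟩ := Nat.exists_eq_add_of_le hj
      have hab : a + b = 2 * x + 1 + i + j + 1 := by lia
      have h1 := choose_pred_mul_factorial_mul_factorial hab
      have h2 := choose_mul_factorial_mul_factorial_succ hab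
      have h3 := Nat.factorial_mul_descFactorial hi
      have h4 := Nat.factorial_mul_descFactorial hj
      have hE : reducedEntry x i j =
          (((if 0 < a then (2 * x + 1 + i + j).choose (a - 1) else 0) +
            2 * (2 * x + 1 + i + j).choose a : ℕ) : ℤ) := by
        rw [reducedEntry, if_pos hi, show x + 2 * j - i = a by lia]
        have : i < x + 2 * j ↔ 0 < a := by lia
        simp only [this]
        push_cast
        rfl
      rw [show x + 2 * j - i = a by lia] at h3
      rw [show x + 2 * i + 2 - j = b by lia] at h4
      rw [hE, ← h3, ← h4]
      set c := if 0 < a then (2 * x + 1 + i + j).choose (a - 1) else 0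
      have hc : (a : ℚ) + 2 * b = 3 * x + 3 * i + 4 := by
        have : a + 2 * b = 3 * x + 3 * i + 4 := by lia
        exact_mod_cast this
      rw [← hc]
      rw [show 2 * x + 1 + (i + j) = 2 * x + 1 + i + j by ring] at hr
      have h1' : (c : ℚ) * (a.factorial * b.factorial) = a * (2 * x + 1 + i + j).factorial := by
        exact_mod_cast h1
      have h2' : ((2 * x + 1 + i + j).choose a : ℚ) * (a.factorial * b.factorial) =
        b * (2 * x + 1 + i + j).factorial := by exact_mod_cast h2
      simp only [Nat.cast_add, Nat.cast_mul, Int.cast_add, Int.cast_mul, Int.cast_natCast,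
        Int.cast_ofNat, Nat.cast_ofNat] at hr ⊢
      set D : ℚ := ((x + 2 * j).descFactorial i : ℚ) * ((x + 2 * i + 2).descFactorial j : ℚ)
      linear_combination D * h1' + 2 * D * h2' - (a + 2 * b) * D * hr
    · rw [Nat.descFactorial_eq_zero_iff_lt.2 hj, reducedEntry,
        Nat.choose_eq_zero_of_lt (show 2 * x + 1 + i + j < x + 2 * j - i - 1 by lia),
        Nat.choose_eq_zero_of_lt (show 2 * x + 1 + i + j < x + 2 * j - i by lia)]
      simp
  · rw [Nat.descFactorial_eq_zero_iff_lt.2 hi, reducedEntry, if_neg (by lia), if_neg (by lia)]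
    simp

theorem det_reducedEntry_mul (x m : ℕ) :
    ((Matrix.of fun i j : Fin m => reducedEntry x i j).det : ℚ) *
        ∏ i ∈ range m, (((x + 2 * i + 2).factorial : ℚ) * (x + 2 * i).factorial) =
      (∏ i ∈ range m, ((3 * x + 3 * i + 4 : ℚ) * (2 * x + 1).factorial)) *
        hyperProd ((x + 2 : ℤ) : ℚ) ((x : ℤ) : ℚ) m := by
  rw [← det_hyperEntry _ _ (by lia) (by lia),
    ← Fin.prod_univ_eq_prod_range (fun i => (3 * x + 3 * i + 4 : ℚ) * (2 * x + 1).factorial),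
    ← Matrix.det_mul_column, prod_mul_distrib,
    ← Fin.prod_univ_eq_prod_range (fun i => ((x + 2 * i + 2).factorial : ℚ)),
    ← Fin.prod_univ_eq_prod_range (fun i => ((x + 2 * i).factorial : ℚ)),
    show ((Matrix.of fun i j : Fin m => reducedEntry x i j).det : ℚ) =
      (Matrix.of fun i j : Fin m => (reducedEntry x i j : ℚ)).det from
      Int.cast_det (R := ℚ) (Matrix.of fun i j : Fin m => reducedEntry x i j),
    mul_left_comm, mul_comm (Matrix.det _), ← Matrix.det_mul_row, ← Matrix.det_mul_column]
  congr 1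
  ext i j
  simp only [Matrix.of_apply]
  rw [← reducedEntry_mul_factorial]
  ring

theorem det_reducedEntry_ne_zero (x m : ℕ) :
    ((Matrix.of fun i j : Fin m => reducedEntry x i j).det : ℚ) ≠ 0 := by
  intro h
  have key := det_reducedEntry_mul x m
  rw [h, zero_mul] at key
  refine (mul_pos (prod_pos fun i _ => ?_) (hyperProd_pos ?_ ?_ m)).ne key
  all_goals push_cast; positivity

theorem det_reducedEntry_succ (x k : ℕ) :
    ((Matrix.of fun i j : Fin (k + 1) => reducedEntry x i j).det : ℚ) *
        ((x + 2 * k + 2).factorial * (x + 2 * k).factorial * (3 * x + 2 * k + 3).factorial *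
          (3 * x + 2 * k + 1).factorial) =
      ((Matrix.of fun i j : Fin k => reducedEntry x i j).det : ℚ) *
        (k.factorial * (2 * x + k + 1).factorial * (3 * x + 3 * k + 4).factorial *
          (3 * x + 3 * k + 1).factorial) := by
  have h0 := det_reducedEntry_mul x k
  have h1 := det_reducedEntry_mul x (k + 1)
  have hP : ∏ i ∈ range k, (((x + 2 * i + 2).factorial : ℚ) * (x + 2 * i).factorial) ≠ 0 :=
    prod_ne_zero_iff.2 fun i _ => by positivity
  rw [prod_range_succ, prod_range_succ, hyperProd_succ] at h1
  have r1 := risingFac_mul_factorial (2 * x + 1) k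
  have r2 := risingFac_mul_factorial (3 * x + 2 * k + 3) k
  have r3 := risingFac_mul_factorial (3 * x + 2 * k + 1) k
  rw [show 2 * x + 1 + k = 2 * x + k + 1 by ring] at r1
  rw [show 3 * x + 2 * k + 3 + k = 3 * x + 3 * k + 3 by ring] at r2
  rw [show 3 * x + 2 * k + 1 + k = 3 * x + 3 * k + 1 by ring] at r3
  rw [show ((x + 2 : ℤ) : ℚ) + ((x : ℤ) : ℚ) = ((2 * x + 1 : ℕ) : ℚ) + 1 by push_cast; ring,
    show 2 * ((x + 2 : ℤ) : ℚ) + ((x : ℤ) : ℚ) + 2 * (k : ℚ) =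
      ((3 * x + 2 * k + 3 : ℕ) : ℚ) + 1 by push_cast; ring,
    show ((x + 2 : ℤ) : ℚ) + 2 * ((x : ℤ) : ℚ) + 2 * (k : ℚ) =
      ((3 * x + 2 * k + 1 : ℕ) : ℚ) + 1 by push_cast; ring] at h1
  rw [show (3 * x + 3 * k + 4).factorial = (3 * x + 3 * k + 4) * (3 * x + 3 * k + 3).factorial from
    Nat.factorial_succ _, ← r1, ← r3]
  push_cast [← r2] at h0 h1 ⊢
  apply mul_left_cancel₀ hP
  linear_combination ((3 * x + 2 * k + 3).factorial * (3 * x + 2 * k + 1).factorial : ℚ) * h1 -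
    (k.factorial * (risingFac (2 * x + 1 + 1) k * (2 * x + 1).factorial) * ((3 * x + 3 * k + 4) *
      (risingFac (3 * x + 2 * k + 3 + 1) k * (3 * x + 2 * k + 3).factorial)) *
      (risingFac (3 * x + 2 * k + 1 + 1) k * (3 * x + 2 * k + 1).factorial)) * h0

theorem Sminor_add_two (x k : ℕ) :
    (Sminor x (k + 2) : ℚ) = Sminor x k *
      (((3 * x + 3 * k + 1).factorial : ℚ) /
          (((3 * x + 2 * k + 1).factorial : ℚ) * ((x + 2 * k).factorial : ℚ)) *
        (((3 * x + 3 * (k + 1) + 1).factorial : ℚ) /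
          (((3 * x + 2 * (k + 1) + 1).factorial : ℚ) * ((x + 2 * (k + 1)).factorial : ℚ))) *
        ((2 * x + k + 1).factorial * k.factorial)) := by
  have hS : (Sminor x k : ℚ) * (Matrix.of fun i j : Fin (k + 1) => reducedEntry x i j).det =
      Sminor x (k + 2) * (Matrix.of fun i j : Fin k => reducedEntry x i j).det := by
    exact_mod_cast Sminor_mul_det_reducedEntry x k
  have hd := det_reducedEntry_succ x k
  refine mul_right_cancel₀ (det_reducedEntry_ne_zero x k) ?_
  rw [← hS, show 3 * x + 3 * (k + 1) + 1 = 3 * x + 3 * k + 4 by ring,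
    show 3 * x + 2 * (k + 1) + 1 = 3 * x + 2 * k + 3 by ring,
    show x + 2 * (k + 1) = x + 2 * k + 2 by ring]
  field_simp
  linear_combination (Sminor x k : ℚ) * hd

theorem Sminor_two_mul (x m : ℕ) :
    (Sminor x (2 * m) : ℚ) =
      (∏ i ∈ range (2 * m), ((3 * x + 3 * i + 1).factorial : ℚ) /
        (((3 * x + 2 * i + 1).factorial : ℚ) * ((x + 2 * i).factorial : ℚ))) *
      ∏ i ∈ range m, (((2 * x + 2 * i + 1).factorial : ℚ) * ((2 * i).factorial : ℚ)) := by
  induction m with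
  | zero => simp [Sminor_zero]
  | succ m ih =>
    rw [show 2 * (m + 1) = 2 * m + 2 by ring, Sminor_add_two, ih, prod_range_succ _ (2 * m + 1),
      prod_range_succ _ (2 * m), prod_range_succ _ m]
    ring

theorem Sminor_two_mul_add_one (x m : ℕ) :
    (Sminor x (2 * m + 1) : ℚ) = 2 ^ x *
      (∏ i ∈ Ico 1 (2 * m + 1), ((3 * x + 3 * i + 1).factorial : ℚ) /
        (((3 * x + 2 * i + 1).factorial : ℚ) * ((x + 2 * i).factorial : ℚ))) *
      ∏ i ∈ Icc 1 m, (((2 * x + 2 * i).factorial : ℚ) * ((2 * i - 1).factorial : ℚ)) := by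
  induction m with
  | zero => simp [Sminor_one]
  | succ m ih =>
    rw [show 2 * (m + 1) + 1 = 2 * m + 1 + 2 by ring, Sminor_add_two, ih,
      prod_Ico_succ_top (b := 2 * m + 1 + 1) (by lia), prod_Ico_succ_top (b := 2 * m + 1) (by lia),
      prod_Icc_succ_top (by lia), show 2 * x + (2 * m + 1) + 1 = 2 * x + 2 * (m + 1) by ring,
      show 2 * (m + 1) - 1 = 2 * m + 1 by lia]
    ring

/-- Theorem 11 (the Robbins–Zeilberger conjecture). -/
theorem thm11 (x n : ℕ) (hn : 0 < n) :
    (Even n →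
      (Sminor x n : ℚ) =
        (∏ i ∈ Finset.range n,
            (Nat.factorial (3 * x + 3 * i + 1) : ℚ) /
              ((Nat.factorial (3 * x + 2 * i + 1) : ℚ) * (Nat.factorial (x + 2 * i) : ℚ))) *
        (∏ i ∈ Finset.range ((n - 2) / 2 + 1),
            (Nat.factorial (2 * x + 2 * i + 1) : ℚ) * (Nat.factorial (2 * i) : ℚ))) ∧
    (Odd n →
      (Sminor x n : ℚ) =
        2 ^ x *
        (∏ i ∈ Finset.Ico 1 n,
            (Nat.factorial (3 * x + 3 * i + 1) : ℚ) /
              ((Nat.factorial (3 * x + 2 * i + 1) : ℚ) * (Nat.factorial (x + 2 * i) : ℚ))) *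
        (∏ i ∈ Finset.Icc 1 ((n - 1) / 2),
            (Nat.factorial (2 * x + 2 * i) : ℚ) * (Nat.factorial (2 * i - 1) : ℚ))) := by
  refine ⟨fun ⟨m, hm⟩ => ?_, fun ⟨m, hm⟩ => ?_⟩
  · rw [hm, ← two_mul, Sminor_two_mul, show (2 * m - 2) / 2 + 1 = m by lia]
  · rw [hm, Sminor_two_mul_add_one, show (2 * m + 1 - 1) / 2 = m by lia]
end
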